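/- arXiv:math/0408030 — 4 statements merged into one kernel-verified Lean document; each statement's English description precedes it below -/
import Mathlib

section
/- The constant 2 in the spherical entropy inequality ∑_{j=1}^N S(f_j) ≤ 2 S(F) is sharp: there exists a family of probability densities F_ε on S^{N-1} (indicator of a spherical cap of radius ε, normalized) such that ∑_{j=1}^N S((F_ε)_j) / S(F_ε) → 2 as ε → 0. -/
open MeasureTheory ENNReal Filter

/-- The uniform Borel probability measure on the unit sphere `S^{N-1} ⊆ ℝ^N`. -/
noncomputable def sphereUniform (N : ℕ) :
    Measure (Metric.sphere (0 : EuclideanSpace ℝ (Fin N)) 1) :=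
  ((volume : Measure (EuclideanSpace ℝ (Fin N))).toSphere Set.univ)⁻¹ •
    (volume : Measure (EuclideanSpace ℝ (Fin N))).toSphere

/-- The σ-algebra on the sphere generated by the `j`-th coordinate function. -/
def coordSigma (N : ℕ) (j : Fin N) :
    MeasurableSpace (Metric.sphere (0 : EuclideanSpace ℝ (Fin N)) 1) :=
  MeasurableSpace.comap (fun v => (v : EuclideanSpace ℝ (Fin N)) j) inferInstance

/-- The spherical cap of (euclidean) radius `ε` centred at `(1,0,…,0)`. -/
def sphereCap (N : ℕ) (hN : 2 ≤ N) (ε : ℝ) :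
    Set (Metric.sphere (0 : EuclideanSpace ℝ (Fin N)) 1) :=
  {v | ‖(v : EuclideanSpace ℝ (Fin N)) -
      EuclideanSpace.single (⟨0, by omega⟩ : Fin N) (1 : ℝ)‖ < ε}

lemma sphereUniform_eq_const_mul_volume_cone (n : ℕ) :
    ∃ κ : ℝ≥0∞, κ ≠ 0 ∧ κ ≠ ⊤ ∧
      ∀ s : Set (Metric.sphere (0 : EuclideanSpace ℝ (Fin (n + 1))) 1), MeasurableSet s →
        sphereUniform (n + 1) s = κ * volume {x : Fin (n + 1) → ℝ |
          ∃ t ∈ Set.Ioo (0 : ℝ) 1, ∃ v ∈ s, ∀ i, x i = t * (v : EuclideanSpace ℝ (Fin (n + 1))) i} := by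
  have hU0 : (volume : Measure (EuclideanSpace ℝ (Fin (n + 1)))).toSphere Set.univ ≠ 0 := by
    rw [Measure.toSphere_apply_univ]
    refine mul_ne_zero (by simp) ?_
    exact (Metric.measure_ball_pos _ _ one_pos).ne'
  have hUt : (volume : Measure (EuclideanSpace ℝ (Fin (n + 1)))).toSphere Set.univ ≠ ⊤ :=
    measure_ne_top _ _
  refine ⟨((volume : Measure (EuclideanSpace ℝ (Fin (n + 1)))).toSphere Set.univ)⁻¹ *
    ((n + 1 : ℕ) : ℝ≥0∞), ?_, ?_, ?_⟩
  · exact mul_ne_zero (ENNReal.inv_ne_zero.2 hUt) (by simp)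
  · exact ENNReal.mul_ne_top (ENNReal.inv_ne_top.2 hU0) (by simp)
  · intro s hs
    rw [sphereUniform, Measure.smul_apply, Measure.toSphere_apply' _ hs, smul_eq_mul, mul_assoc]
    congr 2
    · simp
    · rw [← (EuclideanSpace.volume_preserving_symm_measurableEquiv_toLp
        (Fin (n + 1))).measure_preimage_equiv]
      congr 1
      ext x
      simp only [Set.mem_smul, Set.mem_image, Set.mem_preimage, Set.mem_ofPred_eq]
      constructor
      · rintro ⟨t, ht, _, ⟨v, hv, rfl⟩, rfl⟩
        exact ⟨t, ht, v, hv, fun i => by simp⟩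
      · rintro ⟨t, ht, v, hv, h⟩
        refine ⟨t, ht, _, ⟨v, hv, rfl⟩, ?_⟩
        ext i
        simpa using (h i).symm

lemma volume_box {n : ℕ} (k : Fin (n + 1)) (a a' b b' : ℝ) :
    volume {x : Fin (n + 1) → ℝ | x k ∈ Set.Ioo a a' ∧ ∀ i, i ≠ k → x i ∈ Set.Ioo b b'} =
      ENNReal.ofReal (a' - a) * ENNReal.ofReal (b' - b) ^ n := by
  have : {x : Fin (n + 1) → ℝ | x k ∈ Set.Ioo a a' ∧ ∀ i, i ≠ k → x i ∈ Set.Ioo b b'} =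
      Set.univ.pi fun i => Set.Ioo (if i = k then a else b) (if i = k then a' else b') := by
    ext x
    simp only [Set.mem_ofPred_eq, Set.mem_univ_pi]
    constructor
    · rintro ⟨h1, h2⟩ i
      by_cases h : i = k
      · subst h; simpa using h1
      · simpa [h] using h2 i h
    · intro h
      exact ⟨by simpa using h k, fun i hi => by simpa [hi] using h i⟩
  rw [this, Real.volume_pi_Ioo, Fin.prod_univ_succAbove _ k]
  simp [Fin.succAbove_ne]

lemma measurableSet_box {n : ℕ} (k : Fin (n + 1)) (a a' b b' : ℝ) :
    MeasurableSet
      {x : Fin (n + 1) → ℝ | x k ∈ Set.Ioo a a' ∧ ∀ i, i ≠ k → x i ∈ Set.Ioo b b'} := by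
  simp only [Set.mem_Ioo, measurableSet_setOfPred]
  measurability

/-- The sine of the angle whose tangent is `r`. -/
noncomputable def sinOfTan (r : ℝ) : ℝ := r / √(1 + r ^ 2)

@[fun_prop]
lemma measurable_sinOfTan : Measurable sinOfTan := by
  unfold sinOfTan; fun_prop

lemma sinOfTan_div {a ρ : ℝ} (hρ : 0 < ρ) : sinOfTan (a / ρ) = a / √(a ^ 2 + ρ ^ 2) := by
  have h1 : 1 + (a / ρ) ^ 2 = (a ^ 2 + ρ ^ 2) / ρ ^ 2 := by field_simp; ring
  have h2 : 0 < √(a ^ 2 + ρ ^ 2) := by positivity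
  rw [sinOfTan, h1, Real.sqrt_div (by positivity), Real.sqrt_sq hρ.le]
  field_simp

/-- The points `x` whose coordinates other than the `j`-th lie in `Y`,
and with `x j / ‖x‖ ∈ B`. -/
def angularCylinder {n : ℕ} (j : Fin (n + 1)) (Y : Set (Fin n → ℝ)) (B : Set ℝ) :
    Set (Fin (n + 1) → ℝ) :=
  {x | (fun i => x (j.succAbove i)) ∈ Y ∧
    sinOfTan (x j / √(∑ i, x (j.succAbove i) ^ 2)) ∈ B}

lemma volume_angularCylinder {n : ℕ} (j : Fin (n + 1)) {Y : Set (Fin n → ℝ)} {B : Set ℝ}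
    (hY : MeasurableSet Y) (hB : MeasurableSet B) (hpos : ∀ y ∈ Y, 0 < √(∑ i, y i ^ 2)) :
    volume (angularCylinder j Y B) =
      (∫⁻ y in Y, ENNReal.ofReal √(∑ i, y i ^ 2)) * volume (sinOfTan ⁻¹' B) := by
  have hBm : MeasurableSet (sinOfTan ⁻¹' B) := measurable_sinOfTan hB
  set U : Set (ℝ × (Fin n → ℝ)) := {p | p.2 ∈ Y ∧ sinOfTan (p.1 / √(∑ i, p.2 i ^ 2)) ∈ B} with hU
  have hUm : MeasurableSet U := by
    refine (measurable_snd hY).inter (s₂ := {p | sinOfTan (p.1 / √(∑ i, p.2 i ^ 2)) ∈ B}) ?_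
    have : Measurable fun p : ℝ × (Fin n → ℝ) => sinOfTan (p.1 / √(∑ i, p.2 i ^ 2)) := by fun_prop
    exact this hB
  have hpre : angularCylinder j Y B =
      (MeasurableEquiv.piFinSuccAbove (fun _ : Fin (n + 1) => ℝ) j) ⁻¹' U := rfl
  rw [hpre, (volume_preserving_piFinSuccAbove (fun _ : Fin (n + 1) => ℝ) j).measure_preimage_equiv]
  change (Measure.prod volume volume) U = _
  rw [Measure.prod_apply_symm hUm, ← lintegral_mul_const _ (by fun_prop),
    ← lintegral_indicator hY]
  refine lintegral_congr fun y => ?_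
  by_cases hy : y ∈ Y
  · have hr := hpos y hy
    have : (fun x => (x, y)) ⁻¹' U =
        (fun x => x * (√(∑ i, y i ^ 2))⁻¹) ⁻¹' (sinOfTan ⁻¹' B) := by
      ext s
      simp [hU, hy, div_eq_mul_inv]
    rw [this, Real.volume_preimage_mul_right (inv_ne_zero hr.ne'), inv_inv, abs_of_pos hr,
      Set.indicator_of_mem hy]
  · have : (fun x => (x, y)) ⁻¹' U = ∅ := by
      ext s
      simp [hU, hy]
    rw [this, Set.indicator_of_notMem hy, measure_empty]

lemma measurableSet_sphere_coord_mem {N : ℕ} (j : Fin N) {B : Set ℝ} (hB : MeasurableSet B) :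
    MeasurableSet {v : Metric.sphere (0 : EuclideanSpace ℝ (Fin N)) 1 |
      (v : EuclideanSpace ℝ (Fin N)) j ∈ B} := by
  have : Measurable fun v : Metric.sphere (0 : EuclideanSpace ℝ (Fin N)) 1 =>
      (v : EuclideanSpace ℝ (Fin N)) j := by fun_prop
  exact this hB

lemma measurableSet_sphereCap (N : ℕ) (hN : 2 ≤ N) (ε : ℝ) : MeasurableSet (sphereCap N hN ε) := by
  refine IsOpen.measurableSet ?_
  exact isOpen_lt (by fun_prop) continuous_const

lemma sum_sq_sphere {N : ℕ} (v : Metric.sphere (0 : EuclideanSpace ℝ (Fin N)) 1) :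
    ∑ i, (v : EuclideanSpace ℝ (Fin N)) i ^ 2 = 1 := by
  rw [← EuclideanSpace.real_norm_sq_eq, norm_eq_of_mem_sphere, one_pow]

lemma abs_sphere_coord_le_one {N : ℕ} (v : Metric.sphere (0 : EuclideanSpace ℝ (Fin N)) 1)
    (i : Fin N) : |(v : EuclideanSpace ℝ (Fin N)) i| ≤ 1 := by
  have := PiLp.norm_apply_le (v : EuclideanSpace ℝ (Fin N)) i
  rwa [norm_eq_of_mem_sphere, Real.norm_eq_abs] at this

lemma norm_sub_single_sq {m : ℕ} (v : Metric.sphere (0 : EuclideanSpace ℝ (Fin (m + 2))) 1) :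
    ‖(v : EuclideanSpace ℝ (Fin (m + 2))) - EuclideanSpace.single 0 1‖ ^ 2 =
      2 * (1 - (v : EuclideanSpace ℝ (Fin (m + 2))) 0) := by
  have h := sum_sq_sphere v
  rw [EuclideanSpace.real_norm_sq_eq]
  rw [Fin.sum_univ_succ] at h ⊢
  simp [Fin.succ_ne_zero]
  linear_combination h

lemma abs_coord_lt_of_mem_sphereCap {m : ℕ} {hN : 2 ≤ m + 2} {ε : ℝ}
    {v : Metric.sphere (0 : EuclideanSpace ℝ (Fin (m + 2))) 1} (hv : v ∈ sphereCap (m + 2) hN ε)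
    {i : Fin (m + 2)} (hi : i ≠ 0) : |(v : EuclideanSpace ℝ (Fin (m + 2))) i| < ε := by
  have h := PiLp.norm_apply_le
    ((v : EuclideanSpace ℝ (Fin (m + 2))) - EuclideanSpace.single 0 1) i
  simp [hi] at h
  exact h.trans_lt hv

lemma half_lt_coord_of_mem_sphereCap {m : ℕ} {hN : 2 ≤ m + 2} {ε : ℝ} (hε : ε ≤ 1 / 2)
    {v : Metric.sphere (0 : EuclideanSpace ℝ (Fin (m + 2))) 1}
    (hv : v ∈ sphereCap (m + 2) hN ε) : 1 / 2 < (v : EuclideanSpace ℝ (Fin (m + 2))) 0 := by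
  have h := PiLp.norm_apply_le
    ((v : EuclideanSpace ℝ (Fin (m + 2))) - EuclideanSpace.single 0 1) 0
  simp at h
  have h2 : |(v : EuclideanSpace ℝ (Fin (m + 2))) 0 - 1| < ε := h.trans_lt hv
  have := (abs_lt.1 h2).1
  linarith

lemma exists_le_measure_sphereCap (m : ℕ) (hN : 2 ≤ m + 2) :
    ∃ c : ℝ, 0 < c ∧ ∀ ε ∈ Set.Ioc (0 : ℝ) (1 / 2),
      ENNReal.ofReal (c * ε ^ (m + 1)) ≤ sphereUniform (m + 2) (sphereCap (m + 2) hN ε) := by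
  obtain ⟨κ, hκ0, hκt, hκ⟩ := sphereUniform_eq_const_mul_volume_cone (m + 1)
  set δ : ℝ := 1 / (8 * (m + 2)) with hδ
  have hδ0 : 0 < δ := by positivity
  have hδ1 : (m + 2) * δ ^ 2 * 64 * (m + 2) = 1 := by rw [hδ]; field_simp; norm_num
  have hκr : 0 < κ.toReal := ENNReal.toReal_pos hκ0 hκt
  refine ⟨κ.toReal * ((1 / 4) * (2 * δ) ^ (m + 1)), by positivity, fun ε hε => ?_⟩
  have hε0 := hε.1
  have hε1 := hε.2
  rw [hκ _ (measurableSet_sphereCap _ _ _)]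
  have hvol := volume_box (n := m + 1) 0 (1 / 4) (1 / 2) (-(δ * ε)) (δ * ε)
  have heq : ENNReal.ofReal (κ.toReal * ((1 / 4) * (2 * δ) ^ (m + 1)) * ε ^ (m + 1)) =
      κ * (ENNReal.ofReal (1 / 2 - 1 / 4) * ENNReal.ofReal (δ * ε - -(δ * ε)) ^ (m + 1)) := by
    have e1 : κ = ENNReal.ofReal κ.toReal := (ENNReal.ofReal_toReal hκt).symm
    conv_rhs => rw [e1]
    rw [← ENNReal.ofReal_pow (by nlinarith), ← ENNReal.ofReal_mul (by norm_num),
      ← ENNReal.ofReal_mul hκr.le]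
    congr 1
    rw [show δ * ε - -(δ * ε) = 2 * δ * ε by ring, mul_pow (2 * δ) ε]
    ring
  rw [heq, ← hvol]
  refine mul_le_mul' le_rfl (measure_mono ?_)
  rintro x ⟨hx0, hx⟩
  have hsum := EuclideanSpace.real_norm_sq_eq (WithLp.toLp 2 x : EuclideanSpace ℝ (Fin (m + 2)))
  set R := ‖(WithLp.toLp 2 x : EuclideanSpace ℝ (Fin (m + 2)))‖ with hR
  simp only at hsum
  rw [Fin.sum_univ_succ] at hsum
  have htail : ∑ i : Fin (m + 1), x i.succ ^ 2 ≤ (m + 2) * δ ^ 2 * ε ^ 2 := by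
    calc ∑ i : Fin (m + 1), x i.succ ^ 2 ≤ ∑ i : Fin (m + 1), (δ * ε) ^ 2 := by
          refine Finset.sum_le_sum fun i _ => ?_
          have := hx i.succ (Fin.succ_ne_zero i)
          exact sq_le_sq' this.1.le this.2.le
      _ = (m + 1) * (δ * ε) ^ 2 := by simp
      _ ≤ (m + 2) * δ ^ 2 * ε ^ 2 := by nlinarith [sq_nonneg (δ * ε)]
  have htail0 : 0 ≤ ∑ i : Fin (m + 1), x i.succ ^ 2 := by positivity
  set T := ∑ i : Fin (m + 1), x i.succ ^ 2
  have hx1 : x 0 ∈ Set.Ioo (1 / 4 : ℝ) (1 / 2) := by simpa using hx0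
  have hmδ : 128 * ((m + 2) * δ ^ 2) ≤ 1 := by
    have hm : (0 : ℝ) ≤ m := by positivity
    have : 0 ≤ (m + 2) * δ ^ 2 * m := by positivity
    nlinarith
  have hT : 128 * T ≤ ε ^ 2 := by nlinarith [sq_nonneg ε]
  have hR0 : 0 ≤ R := norm_nonneg _
  have hR1 : R < 1 := by nlinarith [hx1.1, hx1.2]
  have hRx : x 0 ≤ R := by nlinarith [hx1.1, hx1.2]
  have hRpos : 0 < R := by linarith [hx1.1]
  have hv : ‖R⁻¹ • (WithLp.toLp 2 x : EuclideanSpace ℝ (Fin (m + 2)))‖ = 1 := by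
    rw [norm_smul, ← hR, norm_inv, Real.norm_of_nonneg hR0, inv_mul_cancel₀ hRpos.ne']
  refine ⟨R, ⟨hRpos, hR1⟩, ⟨R⁻¹ • WithLp.toLp 2 x, by simpa using hv⟩, ?_, fun i => ?_⟩
  · have hn := norm_sub_single_sq (m := m) ⟨R⁻¹ • WithLp.toLp 2 x, by simpa using hv⟩
    simp only [PiLp.smul_apply, smul_eq_mul] at hn
    have hb : 2 * (1 - R⁻¹ * x 0) < ε ^ 2 := by
      have e : 1 - R⁻¹ * x 0 = (R - x 0) / R := by field_simp
      rw [e, ← mul_div_assoc, div_lt_iff₀ hRpos]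
      have : (R - x 0) * (R + x 0) = T := by linear_combination hsum
      have h2 : (R - x 0) * (1 / 2) ≤ T := by
        rw [← this]
        refine mul_le_mul_of_nonneg_left (by linarith [hx1.1]) (by linarith)
      nlinarith [hx1.1, sq_pos_of_pos hε0]
    rw [← hn] at hb
    exact lt_of_pow_lt_pow_left₀ 2 hε0.le hb
  · simp [mul_inv_cancel_left₀ hRpos.ne']

lemma exists_measure_coord_lt_le (m : ℕ) :
    ∃ C : ℝ, 0 < C ∧ ∀ ε > 0, ∀ j : Fin (m + 2),
      sphereUniform (m + 2) {v | (v : EuclideanSpace ℝ (Fin (m + 2))) j ∈ Set.Ioo (-ε) ε} ≤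
        ENNReal.ofReal (C * ε) := by
  obtain ⟨κ, hκ0, hκt, hκ⟩ := sphereUniform_eq_const_mul_volume_cone (m + 1)
  have hκr : 0 < κ.toReal := ENNReal.toReal_pos hκ0 hκt
  refine ⟨κ.toReal * (2 * 2 ^ (m + 1)), by positivity, fun ε hε j => ?_⟩
  rw [hκ _ (measurableSet_sphere_coord_mem j measurableSet_Ioo)]
  have hvol := volume_box (n := m + 1) j (-ε) ε (-1) 1
  have heq : ENNReal.ofReal (κ.toReal * (2 * 2 ^ (m + 1)) * ε) =
      κ * (ENNReal.ofReal (ε - -ε) * ENNReal.ofReal (1 - -1) ^ (m + 1)) := by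
    have e1 : κ = ENNReal.ofReal κ.toReal := (ENNReal.ofReal_toReal hκt).symm
    conv_rhs => rw [e1]
    rw [← ENNReal.ofReal_pow (by norm_num), ← ENNReal.ofReal_mul (by linarith),
      ← ENNReal.ofReal_mul hκr.le]
    congr 1
    norm_num
    ring
  rw [heq, ← hvol]
  refine mul_le_mul' le_rfl (measure_mono ?_)
  rintro x ⟨t, ⟨ht0, ht1⟩, v, hv, h⟩
  refine ⟨?_, fun i _ => ?_⟩
  · rw [h, Set.mem_Ioo, ← abs_lt, abs_mul, abs_of_pos ht0]
    have := abs_lt.2 hv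
    nlinarith [abs_nonneg ((v : EuclideanSpace ℝ (Fin (m + 2))) j)]
  · rw [h, Set.mem_Ioo, ← abs_lt, abs_mul, abs_of_pos ht0]
    have := abs_sphere_coord_le_one v i
    nlinarith [abs_nonneg ((v : EuclideanSpace ℝ (Fin (m + 2))) i)]

lemma sqrt_sum_sq_bounds {n : ℕ} (k : Fin (n + 1)) {y : Fin (n + 1) → ℝ} {a b : ℝ} (ha : 0 < a)
    (hk : a < y k) (hy : ∀ i, |y i| ≤ b) :
    a ≤ √(∑ i, y i ^ 2) ∧ √(∑ i, y i ^ 2) ≤ (n + 1) * b := by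
  constructor
  · refine Real.le_sqrt_of_sq_le ?_
    calc a ^ 2 ≤ y k ^ 2 := by gcongr
      _ ≤ _ := Finset.single_le_sum (f := fun i => y i ^ 2) (fun i _ => sq_nonneg _)
        (Finset.mem_univ k)
  · have hb : 0 ≤ b := (abs_nonneg _).trans (hy k)
    refine Real.sqrt_le_iff.2 ⟨by positivity, ?_⟩
    calc ∑ i, y i ^ 2 ≤ ∑ _i : Fin (n + 1), b ^ 2 := by
          refine Finset.sum_le_sum fun i _ => sq_le_sq.2 ?_
          rw [abs_of_nonneg hb]; exact hy i
      _ = (n + 1) * b ^ 2 := by simp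
      _ ≤ ((n + 1) * b) ^ 2 := by
        have : (0 : ℝ) ≤ n * b ^ 2 := by positivity
        have : (0 : ℝ) ≤ n * (n * b ^ 2) := by positivity
        nlinarith

lemma exists_measure_sphereCap_inter_le (m : ℕ) (hN : 2 ≤ m + 2) :
    ∃ C : ℝ, 0 < C ∧ ∀ ε ∈ Set.Ioc (0 : ℝ) (1 / 2), ∀ j : Fin (m + 2), j ≠ 0 →
      ∀ B : Set ℝ, MeasurableSet B → B ⊆ Set.Ioo (-ε) ε →
      sphereUniform (m + 2) (sphereCap (m + 2) hN ε ∩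
          {v | (v : EuclideanSpace ℝ (Fin (m + 2))) j ∈ B}) ≤
        ENNReal.ofReal (C * ε ^ m) *
          sphereUniform (m + 2) {v | (v : EuclideanSpace ℝ (Fin (m + 2))) j ∈ B} := by
  obtain ⟨κ, hκ0, hκt, hκ⟩ := sphereUniform_eq_const_mul_volume_cone (m + 1)
  set δ : ℝ := 1 / (4 * (m + 1)) with hδ
  have hδ0 : 0 < δ := by positivity
  refine ⟨(m + 1) * 2 ^ m / δ ^ (m + 2), by positivity, fun ε hε j hj B hB hBε => ?_⟩
  obtain ⟨hε0, hε1⟩ := hε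
  obtain ⟨k, hk⟩ := Fin.exists_succAbove_eq hj.symm
  have hBm := measurableSet_sphere_coord_mem j hB
  rw [hκ _ hBm, hκ _ ((measurableSet_sphereCap _ _ _).inter hBm)]
  set Y₁ : Set (Fin (m + 1) → ℝ) :=
    {y | y k ∈ Set.Ioo 0 1 ∧ ∀ i, i ≠ k → y i ∈ Set.Ioo (-ε) ε} with hY₁
  set Y₂ : Set (Fin (m + 1) → ℝ) :=
    {y | y k ∈ Set.Ioo δ (2 * δ) ∧ ∀ i, i ≠ k → y i ∈ Set.Ioo δ (2 * δ)} with hY₂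
  have hY₁m : MeasurableSet Y₁ := measurableSet_box _ _ _ _ _
  have hY₂m : MeasurableSet Y₂ := measurableSet_box _ _ _ _ _
  have hr₁ : ∀ y ∈ Y₁, 0 < √(∑ i, y i ^ 2) ∧ √(∑ i, y i ^ 2) ≤ m + 1 := by
    rintro y ⟨hyk, hy⟩
    have := sqrt_sum_sq_bounds k (y := y) (a := y k / 2) (b := 1) (by linarith [hyk.1])
      (by linarith [hyk.1]) fun i => by
        by_cases hi : i = k
        · subst hi; exact abs_le.2 ⟨by linarith [hyk.1], hyk.2.le⟩
        · exact abs_le.2 ⟨by linarith [(hy i hi).1], by linarith [(hy i hi).2]⟩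
    exact ⟨by linarith [this.1, hyk.1], by linarith [this.2]⟩
  have hr₂ : ∀ y ∈ Y₂, δ ≤ √(∑ i, y i ^ 2) ∧ √(∑ i, y i ^ 2) ≤ 1 / 2 := by
    rintro y ⟨hyk, hy⟩
    have := sqrt_sum_sq_bounds k (y := y) (a := δ) (b := 2 * δ) hδ0 hyk.1 fun i => by
        by_cases hi : i = k
        · subst hi; exact abs_le.2 ⟨by linarith [hyk.1], hyk.2.le⟩
        · exact abs_le.2 ⟨by linarith [(hy i hi).1], by linarith [(hy i hi).2]⟩
    refine ⟨this.1, this.2.trans_eq ?_⟩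
    rw [hδ]; field_simp; norm_num
  have hsub₁ : {x : Fin (m + 2) → ℝ | ∃ t ∈ Set.Ioo (0 : ℝ) 1, ∃ v ∈ sphereCap (m + 2) hN ε ∩
      {v | (v : EuclideanSpace ℝ (Fin (m + 2))) j ∈ B},
      ∀ i, x i = t * (v : EuclideanSpace ℝ (Fin (m + 2))) i} ⊆ angularCylinder j Y₁ B := by
    rintro x ⟨t, ⟨ht0, ht1⟩, v, ⟨hv, hvB⟩, h⟩
    have hY : (fun i => x (j.succAbove i)) ∈ Y₁ := by
      refine ⟨?_, fun i hi => ?_⟩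
      · have h1 := half_lt_coord_of_mem_sphereCap hε1 hv
        have h2 := (abs_le.1 (abs_sphere_coord_le_one v 0)).2
        simp only [hk, h]
        constructor <;> nlinarith
      · have hi0 : j.succAbove i ≠ 0 := fun h0 =>
          hi (Fin.succAbove_right_injective (h0.trans hk.symm))
        have := abs_coord_lt_of_mem_sphereCap hv hi0
        simp only [h]
        rw [Set.mem_Ioo, ← abs_lt, abs_mul, abs_of_pos ht0]
        nlinarith [abs_nonneg ((v : EuclideanSpace ℝ (Fin (m + 2))) (j.succAbove i))]
    refine ⟨hY, ?_⟩
    have hr := (hr₁ _ hY).1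
    rw [sinOfTan_div hr, Real.sq_sqrt (by positivity),
      ← Fin.sum_univ_succAbove (fun i => x i ^ 2) j]
    simp only [h, mul_pow, ← Finset.mul_sum, sum_sq_sphere v, mul_one, Real.sqrt_sq ht0.le]
    rwa [mul_div_cancel_left₀ _ ht0.ne']
  have hsub₂ : angularCylinder j Y₂ B ⊆ {x : Fin (m + 2) → ℝ | ∃ t ∈ Set.Ioo (0 : ℝ) 1,
      ∃ v ∈ {v : Metric.sphere (0 : EuclideanSpace ℝ (Fin (m + 2))) 1 |
        (v : EuclideanSpace ℝ (Fin (m + 2))) j ∈ B},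
      ∀ i, x i = t * (v : EuclideanSpace ℝ (Fin (m + 2))) i} := by
    rintro x ⟨hY, hxB⟩
    obtain ⟨hr, hr'⟩ := hr₂ _ hY
    have hsum := EuclideanSpace.real_norm_sq_eq (WithLp.toLp 2 x : EuclideanSpace ℝ (Fin (m + 2)))
    set R := ‖(WithLp.toLp 2 x : EuclideanSpace ℝ (Fin (m + 2)))‖ with hR
    simp only at hsum
    rw [sinOfTan_div (hδ0.trans_le hr), Real.sq_sqrt (by positivity),
      ← Fin.sum_univ_succAbove (fun i => x i ^ 2) j, ← hsum,
      Real.sqrt_sq (norm_nonneg _)] at hxB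
    rw [Fin.sum_univ_succAbove _ j] at hsum
    have hS : ∑ i, x (j.succAbove i) ^ 2 = √(∑ i, x (j.succAbove i) ^ 2) ^ 2 :=
      (Real.sq_sqrt (by positivity)).symm
    rw [hS] at hsum
    set r := √(∑ i, x (j.succAbove i) ^ 2)
    have hr0 : 0 < r := hδ0.trans_le hr
    have hR0 : 0 ≤ R := norm_nonneg _
    have hRpos : 0 < R := by
      refine lt_of_le_of_ne hR0 fun h0 => ?_
      rw [← h0] at hsum
      nlinarith [sq_nonneg (x j), sq_pos_of_pos hr0]
    have hR1 : R < 1 := by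
      have h1 := hBε hxB
      have h2 : |x j / R| ≤ 1 / 2 := abs_le.2 ⟨by linarith [h1.1], by linarith [h1.2]⟩
      rw [abs_div, abs_of_pos hRpos, div_le_iff₀ hRpos] at h2
      have h3 : x j ^ 2 ≤ (1 / 2 * R) ^ 2 := by
        rw [← sq_abs]; gcongr
      nlinarith
    have hv : ‖R⁻¹ • (WithLp.toLp 2 x : EuclideanSpace ℝ (Fin (m + 2)))‖ = 1 := by
      rw [norm_smul, ← hR, norm_inv, Real.norm_of_nonneg hR0, inv_mul_cancel₀ hRpos.ne']
    refine ⟨R, ⟨hRpos, hR1⟩, ⟨R⁻¹ • WithLp.toLp 2 x, by simpa using hv⟩, ?_, fun i => ?_⟩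
    · simpa [div_eq_inv_mul] using hxB
    · simp [mul_inv_cancel_left₀ hRpos.ne']
  have hupper : ∫⁻ y in Y₁, ENNReal.ofReal √(∑ i, y i ^ 2) ≤
      ENNReal.ofReal (((m + 1) * 2 ^ m) * ε ^ m) := by
    calc ∫⁻ y in Y₁, ENNReal.ofReal √(∑ i, y i ^ 2) ≤ ∫⁻ _y in Y₁, ENNReal.ofReal (m + 1) :=
          setLIntegral_mono' hY₁m fun y hy => ENNReal.ofReal_le_ofReal (hr₁ y hy).2
      _ = ENNReal.ofReal (m + 1) * (ENNReal.ofReal (1 - 0) * ENNReal.ofReal (ε - -ε) ^ m) := by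
          rw [setLIntegral_const, hY₁, volume_box]
      _ = _ := by
          rw [← ENNReal.ofReal_pow (by linarith), ← ENNReal.ofReal_mul (by norm_num),
            ← ENNReal.ofReal_mul (by positivity)]
          congr 1
          rw [show ε - -ε = 2 * ε by ring, mul_pow]
          ring
  have hlower : ENNReal.ofReal (δ ^ (m + 2)) ≤
      ∫⁻ y in Y₂, ENNReal.ofReal √(∑ i, y i ^ 2) := by
    calc ENNReal.ofReal (δ ^ (m + 2)) =
          ENNReal.ofReal δ *
            (ENNReal.ofReal (2 * δ - δ) * ENNReal.ofReal (2 * δ - δ) ^ m) := by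
          rw [show 2 * δ - δ = δ by ring, ← ENNReal.ofReal_pow hδ0.le, ← ENNReal.ofReal_mul hδ0.le,
            ← ENNReal.ofReal_mul hδ0.le]
          congr 1
          ring
      _ = ∫⁻ _y in Y₂, ENNReal.ofReal δ := by rw [setLIntegral_const, hY₂, volume_box]
      _ ≤ _ := setLIntegral_mono' hY₂m fun y hy => ENNReal.ofReal_le_ofReal (hr₂ y hy).1
  have hv₁ := volume_angularCylinder j hY₁m hB fun y hy => (hr₁ y hy).1
  have hv₂ := volume_angularCylinder j hY₂m hB fun y hy => hδ0.trans_le (hr₂ y hy).1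
  calc _ ≤ κ * volume (angularCylinder j Y₁ B) := by gcongr
    _ ≤ κ * (ENNReal.ofReal (((m + 1) * 2 ^ m) * ε ^ m) * volume (sinOfTan ⁻¹' B)) := by
        rw [hv₁]; gcongr
    _ = ENNReal.ofReal ((m + 1) * 2 ^ m / δ ^ (m + 2) * ε ^ m) *
          (κ * (ENNReal.ofReal (δ ^ (m + 2)) * volume (sinOfTan ⁻¹' B))) := by
        have : ((m + 1) * 2 ^ m) * ε ^ m =
            ((m + 1) * 2 ^ m / δ ^ (m + 2) * ε ^ m) * δ ^ (m + 2) := by field_simp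
        rw [this, ENNReal.ofReal_mul (by positivity)]
        ring
    _ ≤ ENNReal.ofReal ((m + 1) * 2 ^ m / δ ^ (m + 2) * ε ^ m) *
          (κ * volume (angularCylinder j Y₂ B)) := by rw [hv₂]; gcongr
    _ ≤ _ := by gcongr

lemma entropy_condExp_bounds {Ω : Type*} {m m₀ : MeasurableSpace Ω} {μ : Measure Ω}
    [IsProbabilityMeasure μ] (hm : m ≤ m₀) {F : Ω → ℝ} (hF : Integrable F μ) (hF0 : 0 ≤ F)
    (hF1 : ∫ x, F x ∂μ = 1) {M b : ℝ} (hb : 0 < b)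
    (hFM : ∀ s, MeasurableSet[m] s → ∫ x in s, F x ∂μ ≤ M * μ.real s)
    {A : Set Ω} (hA : MeasurableSet[m] A) (hFA : A.indicator F = F) (hAb : μ.real A ≤ b) :
    -Real.log b ≤ ∫ x, (μ[F|m]) x * Real.log ((μ[F|m]) x) ∂μ ∧
      ∫ x, (μ[F|m]) x * Real.log ((μ[F|m]) x) ∂μ ≤ Real.log M := by
  have hG0 : ∀ᵐ x ∂μ, 0 ≤ (μ[F|m]) x := condExp_nonneg (ae_of_all _ hF0)
  have hGM : ∀ᵐ x ∂μ, (μ[F|m]) x ≤ M := by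
    refine ae_of_ae_trim hm ?_
    refine ae_le_of_forall_setIntegral_le (μ := μ.trim hm) (g := fun _ => M)
      (integrable_condExp.trim hm stronglyMeasurable_condExp) (integrable_const _) ?_
    intro s hs _
    rw [← setIntegral_trim hm stronglyMeasurable_condExp hs, setIntegral_condExp hm hF hs,
      setIntegral_const, smul_eq_mul, mul_comm, measureReal_def, trim_measurableSet_eq hm hs]
    exact hFM s hs
  have hGA : ∀ᵐ x ∂μ, (μ[F|m]) x = A.indicator (μ[F|m]) x := by
    have := condExp_indicator hF hA
    rwa [hFA] at this
  have hG1 : ∫ x, (μ[F|m]) x ∂μ = 1 := by rw [integral_condExp hm, hF1]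
  have hGint : Integrable (μ[F|m]) μ := integrable_condExp
  have hcont := Real.continuous_mul_log
  have hint : Integrable (fun x => (μ[F|m]) x * Real.log ((μ[F|m]) x)) μ := by
    obtain ⟨K, hK⟩ := (isCompact_Icc (a := (0 : ℝ)) (b := M)).exists_bound_of_continuousOn
      hcont.continuousOn
    refine Integrable.of_bound (hcont.comp_aestronglyMeasurable hGint.aestronglyMeasurable) K ?_
    filter_upwards [hG0, hGM] with x h0 h1 using hK _ ⟨h0, h1⟩
  constructor
  · have hlow : ∀ᵐ x ∂μ, (1 - Real.log b) * (μ[F|m]) x - b⁻¹ * A.indicator (fun _ => 1) x ≤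
        (μ[F|m]) x * Real.log ((μ[F|m]) x) := by
      filter_upwards [hG0, hGA] with x h0 h1
      by_cases hx : x ∈ A
      · rw [Set.indicator_of_mem hx]
        rcases h0.eq_or_lt with h | h
        · rw [← h]; simp [hb.le]
        · have := Real.self_sub_one_le_mul_log (x := b * (μ[F|m]) x) (by positivity)
          rw [Real.log_mul hb.ne' h.ne'] at this
          have h2 := mul_le_mul_of_nonneg_left this (inv_nonneg.2 hb.le)
          have e1 : b⁻¹ * (b * (μ[F|m]) x - 1) = (μ[F|m]) x - b⁻¹ := by field_simp
          have e2 : b⁻¹ * (b * (μ[F|m]) x * (Real.log b + Real.log ((μ[F|m]) x))) =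
            (μ[F|m]) x * (Real.log b + Real.log ((μ[F|m]) x)) := by field_simp
          rw [e1, e2] at h2
          linarith
      · rw [Set.indicator_of_notMem hx] at h1 ⊢
        rw [h1]; simp
    have hiA : Integrable (A.indicator fun _ => (1 : ℝ)) μ :=
      (integrable_const _).indicator (hm _ hA)
    have := integral_mono_ae ((hGint.const_mul _).sub (hiA.const_mul _)) hint hlow
    simp only [Pi.sub_apply] at this
    rw [integral_sub (hGint.const_mul _) (hiA.const_mul _), integral_const_mul, integral_const_mul,
      hG1, integral_indicator_const _ (hm _ hA), smul_eq_mul] at this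
    have hbA : b⁻¹ * (μ.real A * 1) ≤ 1 := by
      rw [mul_one, inv_mul_le_iff₀ hb, mul_one]; exact hAb
    linarith
  · have hup : ∀ᵐ x ∂μ, (μ[F|m]) x * Real.log ((μ[F|m]) x) ≤ Real.log M * (μ[F|m]) x := by
      filter_upwards [hG0, hGM] with x h0 h1
      rw [mul_comm (Real.log M)]
      rcases h0.eq_or_lt with h | h
      · rw [← h]; simp
      · exact mul_le_mul_of_nonneg_left (Real.log_le_log h h1) h0
    have := integral_mono_ae hint (hGint.const_mul _) hup
    rwa [integral_const_mul, hG1, mul_one] at this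

instance isProbabilityMeasure_sphereUniform (n : ℕ) :
    IsProbabilityMeasure (sphereUniform (n + 1)) := by
  constructor
  rw [sphereUniform, Measure.smul_apply, smul_eq_mul]
  refine ENNReal.inv_mul_cancel ?_ (measure_ne_top _ _)
  rw [Measure.toSphere_apply_univ]
  exact mul_ne_zero (by simp) (Metric.measure_ball_pos _ _ one_pos).ne'

/-- The normalized indicator function of the spherical cap of radius `ε`. -/
noncomputable def capDensity (N : ℕ) (hN : 2 ≤ N) (ε : ℝ) :
    Metric.sphere (0 : EuclideanSpace ℝ (Fin N)) 1 → ℝ :=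
  fun v => ((sphereUniform N).real (sphereCap N hN ε))⁻¹ *
    (sphereCap N hN ε).indicator (fun _ => (1 : ℝ)) v

lemma capDensity_nonneg (N : ℕ) (hN : 2 ≤ N) (ε : ℝ) : 0 ≤ capDensity N hN ε := fun v =>
  mul_nonneg (inv_nonneg.2 measureReal_nonneg) (Set.indicator_nonneg (fun _ _ => zero_le_one) v)

lemma integrable_capDensity (m : ℕ) (hN : 2 ≤ m + 2) (ε : ℝ) :
    Integrable (capDensity (m + 2) hN ε) (sphereUniform (m + 2)) :=
  ((integrable_const _).indicator (measurableSet_sphereCap _ _ _)).const_mul _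

lemma setIntegral_capDensity (m : ℕ) (hN : 2 ≤ m + 2) (ε : ℝ)
    (s : Set (Metric.sphere (0 : EuclideanSpace ℝ (Fin (m + 2))) 1)) :
    ∫ v in s, capDensity (m + 2) hN ε v ∂(sphereUniform (m + 2)) =
      ((sphereUniform (m + 2)).real (sphereCap (m + 2) hN ε))⁻¹ *
        (sphereUniform (m + 2)).real (sphereCap (m + 2) hN ε ∩ s) := by
  simp only [capDensity]
  rw [integral_const_mul, integral_indicator_const _ (measurableSet_sphereCap _ _ _), smul_eq_mul,
    mul_one, measureReal_restrict_apply (measurableSet_sphereCap _ _ _)]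

lemma sphereCap_subset {N : ℕ} {hN : 2 ≤ N} {ε ε' : ℝ} (h : ε ≤ ε') :
    sphereCap N hN ε ⊆ sphereCap N hN ε' :=
  fun _ hv => lt_of_lt_of_le (α := ℝ) hv h

lemma measureReal_sphereCap_pos (m : ℕ) (hN : 2 ≤ m + 2) {ε : ℝ} (hε : 0 < ε) :
    0 < (sphereUniform (m + 2)).real (sphereCap (m + 2) hN ε) := by
  obtain ⟨c, hc, h⟩ := exists_le_measure_sphereCap m hN
  have hmin : 0 < min ε (1 / 2) := lt_min hε (by norm_num)
  have h1 := h (min ε (1 / 2)) ⟨hmin, min_le_right _ _⟩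
  refine ENNReal.toReal_pos (ne_of_gt ?_) (measure_ne_top _ _)
  calc 0 < ENNReal.ofReal (c * min ε (1 / 2) ^ (m + 1)) := ENNReal.ofReal_pos.2 (by positivity)
    _ ≤ _ := h1
    _ ≤ _ := measure_mono (sphereCap_subset (min_le_left _ _))

lemma integral_capDensity (m : ℕ) (hN : 2 ≤ m + 2) {ε : ℝ} (hε : 0 < ε) :
    ∫ v, capDensity (m + 2) hN ε v ∂(sphereUniform (m + 2)) = 1 := by
  rw [← setIntegral_univ, setIntegral_capDensity, Set.inter_univ,
    inv_mul_cancel₀ (measureReal_sphereCap_pos m hN hε).ne']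

lemma entropy_capDensity (m : ℕ) (hN : 2 ≤ m + 2) {ε : ℝ} (hε : 0 < ε) :
    ∫ v, capDensity (m + 2) hN ε v * Real.log (capDensity (m + 2) hN ε v)
        ∂(sphereUniform (m + 2)) =
      -Real.log ((sphereUniform (m + 2)).real (sphereCap (m + 2) hN ε)) := by
  have : ∀ v, capDensity (m + 2) hN ε v * Real.log (capDensity (m + 2) hN ε v) =
      capDensity (m + 2) hN ε v *
        -Real.log ((sphereUniform (m + 2)).real (sphereCap (m + 2) hN ε)) := fun v => by
    by_cases hv : v ∈ sphereCap (m + 2) hN ε <;> simp [capDensity, hv, Real.log_inv]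
  simp only [this]
  rw [integral_mul_const, integral_capDensity m hN hε, one_mul]

lemma coordSigma_le (N : ℕ) (j : Fin N) : coordSigma N j ≤ Subtype.instMeasurableSpace := by
  rintro _ ⟨B, hB, rfl⟩
  exact measurableSet_sphere_coord_mem j hB

lemma condExp_capDensity_zero (m : ℕ) (hN : 2 ≤ m + 2) {ε : ℝ} (hε : 0 < ε) :
    (sphereUniform (m + 2))[capDensity (m + 2) hN ε | coordSigma (m + 2) 0] =
      capDensity (m + 2) hN ε := by
  have hcap : MeasurableSet[coordSigma (m + 2) 0] (sphereCap (m + 2) hN ε) := by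
    refine ⟨{r | 2 * (1 - r) < ε ^ 2}, measurableSet_lt (by fun_prop) (by fun_prop), ?_⟩
    ext v
    simp only [Set.mem_preimage, Set.mem_ofPred_eq, ← norm_sub_single_sq]
    exact pow_lt_pow_iff_left₀ (norm_nonneg _) hε.le two_ne_zero
  refine condExp_of_stronglyMeasurable (coordSigma_le _ _) ?_ (integrable_capDensity m hN ε)
  exact (stronglyMeasurable_const.indicator hcap).const_mul _

lemma entropy_condExp_capDensity_bounds (m : ℕ) (hN : 2 ≤ m + 2) :
    ∃ K : ℝ, ∀ ε ∈ Set.Ioc (0 : ℝ) (1 / 2),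
      |(∫ v, capDensity (m + 2) hN ε v * Real.log (capDensity (m + 2) hN ε v)
        ∂(sphereUniform (m + 2))) - (m + 1) * -Real.log ε| ≤ K ∧
      ∀ j : Fin (m + 2), j ≠ 0 →
        |(∫ v, ((sphereUniform (m + 2))[capDensity (m + 2) hN ε | coordSigma (m + 2) j]) v *
          Real.log (((sphereUniform (m + 2))[capDensity (m + 2) hN ε | coordSigma (m + 2) j]) v)
            ∂(sphereUniform (m + 2))) - 1 * -Real.log ε| ≤ K := by
  obtain ⟨c, hc, h1⟩ := exists_le_measure_sphereCap m hN
  obtain ⟨C₁, hC₁, h2⟩ := exists_measure_coord_lt_le m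
  obtain ⟨C₂, hC₂, h3⟩ := exists_measure_sphereCap_inter_le m hN
  refine ⟨max (max |Real.log c| |Real.log (C₁ * C₂)|) (max |Real.log C₁| |Real.log (C₂ / c)|),
    fun ε hε => ?_⟩
  have hε0 := hε.1
  set μ := sphereUniform (m + 2) with hμ
  set p := μ.real (sphereCap (m + 2) hN ε) with hp
  have hp0 : 0 < p := measureReal_sphereCap_pos m hN hε0
  have hcp : c * ε ^ (m + 1) ≤ p :=
    (ENNReal.ofReal_le_iff_le_toReal (measure_ne_top _ _)).1 (h1 ε hε)
  have h2' : ∀ j : Fin (m + 2),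
      μ.real {v | (v : EuclideanSpace ℝ (Fin (m + 2))) j ∈ Set.Ioo (-ε) ε} ≤ C₁ * ε := fun j =>
    ENNReal.toReal_le_of_le_ofReal (by positivity) (h2 ε hε0 j)
  have hsub : ∀ j : Fin (m + 2), j ≠ 0 → sphereCap (m + 2) hN ε ⊆
      {v | (v : EuclideanSpace ℝ (Fin (m + 2))) j ∈ Set.Ioo (-ε) ε} := fun j hj v hv =>
    abs_lt.1 (abs_coord_lt_of_mem_sphereCap hv hj)
  have h3' : ∀ j : Fin (m + 2), j ≠ 0 → ∀ B : Set ℝ, MeasurableSet B →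
      μ.real (sphereCap (m + 2) hN ε ∩ {v | (v : EuclideanSpace ℝ (Fin (m + 2))) j ∈ B}) ≤
        C₂ * ε ^ m * μ.real {v | (v : EuclideanSpace ℝ (Fin (m + 2))) j ∈ B} := by
    intro j hj B hB
    have h := ENNReal.toReal_mono
      (ENNReal.mul_ne_top ENNReal.ofReal_ne_top (measure_ne_top _ _))
      (h3 ε hε j hj (B ∩ Set.Ioo (-ε) ε) (hB.inter measurableSet_Ioo) Set.inter_subset_right)
    rw [ENNReal.toReal_mul, ENNReal.toReal_ofReal (by positivity)] at h
    calc _ ≤ μ.real (sphereCap (m + 2) hN ε ∩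
            {v | (v : EuclideanSpace ℝ (Fin (m + 2))) j ∈ B ∩ Set.Ioo (-ε) ε}) :=
          measureReal_mono fun v hv => ⟨hv.1, hv.2, hsub j hj hv.1⟩
      _ ≤ _ := h
      _ ≤ _ := mul_le_mul_of_nonneg_left (measureReal_mono fun v hv => hv.1) (by positivity)
  constructor
  · refine le_max_of_le_left ?_
    rw [entropy_capDensity m hN hε0, ← hp]
    have hpC : p ≤ C₁ * C₂ * ε ^ (m + 1) := by
      have h := h3' 1 (by simp) (Set.Ioo (-ε) ε) measurableSet_Ioo
      rw [Set.inter_eq_left.2 (hsub 1 (by simp)), ← hp] at h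
      calc p ≤ _ := h
        _ ≤ C₂ * ε ^ m * (C₁ * ε) := mul_le_mul_of_nonneg_left (h2' 1) (by positivity)
        _ = _ := by ring
    have l1 := Real.log_le_log (by positivity) hcp
    have l2 := Real.log_le_log hp0 hpC
    rw [Real.log_mul (by positivity) (by positivity), Real.log_pow] at l1 l2
    push_cast at l1 l2
    rw [abs_le]
    have a1 := le_max_left |Real.log c| |Real.log (C₁ * C₂)|
    have a2 := le_max_right |Real.log c| |Real.log (C₁ * C₂)|
    have a3 := neg_abs_le (Real.log c)
    have a4 := le_abs_self (Real.log (C₁ * C₂))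
    constructor <;> linarith
  · intro j hj
    refine le_max_of_le_right ?_
    have hA : MeasurableSet[coordSigma (m + 2) j]
        {v | (v : EuclideanSpace ℝ (Fin (m + 2))) j ∈ Set.Ioo (-ε) ε} :=
      ⟨Set.Ioo (-ε) ε, measurableSet_Ioo, rfl⟩
    have := entropy_condExp_bounds (coordSigma_le _ j) (integrable_capDensity m hN ε)
      (capDensity_nonneg _ hN ε) (integral_capDensity m hN hε0) (M := C₂ / c * ε⁻¹) (b := C₁ * ε)
      (by positivity) ?_ hA ?_ (h2' j)
    · rw [Real.log_mul hC₁.ne' hε0.ne', Real.log_mul (by positivity) (by positivity),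
        Real.log_inv] at this
      rw [abs_le]
      have a1 := le_max_left |Real.log C₁| |Real.log (C₂ / c)|
      have a2 := le_max_right |Real.log C₁| |Real.log (C₂ / c)|
      have a3 := le_abs_self (Real.log C₁)
      have a4 := le_abs_self (Real.log (C₂ / c))
      constructor <;> linarith [this.1, this.2]
    · rintro _ ⟨B, hB, rfl⟩
      rw [setIntegral_capDensity, ← hμ, ← hp, inv_mul_le_iff₀ hp0]
      refine (h3' j hj B hB).trans ?_
      rw [← mul_assoc]
      refine mul_le_mul_of_nonneg_right ?_ measureReal_nonneg
      calc C₂ * ε ^ m = c * ε ^ (m + 1) * (C₂ / c * ε⁻¹) := by field_simp; ring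
        _ ≤ _ := mul_le_mul_of_nonneg_right hcp (by positivity)
    · rw [Set.indicator_eq_self]
      refine subset_trans (fun v hv => ?_) (hsub j hj)
      by_contra h
      exact hv (by simp [capDensity, h])

lemma tendsto_div_of_abs_sub_le {α : Type*} {l : Filter α} {f L : α → ℝ} {a K : ℝ}
    (hL : Tendsto L l atTop) (h : ∀ᶠ x in l, |f x - a * L x| ≤ K) :
    Tendsto (fun x => f x / L x) l (nhds a) := by
  have h0 : Tendsto (fun x => (f x - a * L x) / L x) l (nhds 0) := by
    refine squeeze_zero_norm' ?_ (hL.const_div_atTop K)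
    filter_upwards [h, hL.eventually_gt_atTop 0] with x hx hx0
    rw [norm_div, Real.norm_eq_abs, Real.norm_of_nonneg hx0.le]
    gcongr
  have := h0.add_const a
  rw [zero_add] at this
  refine this.congr' ?_
  filter_upwards [hL.eventually_gt_atTop 0] with x hx0
  field_simp
  ring

/-- sharpness of the constant 2 in the spherical entropy inequality:
the normalized indicators of small spherical caps have entropy ratio tending to 2. -/
theorem sphere_entropy_constant_sharp (N : ℕ) (hN : 2 ≤ N) :
    ∃ F : ℝ → Metric.sphere (0 : EuclideanSpace ℝ (Fin N)) 1 → ℝ,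
      (∀ ε ∈ Set.Ioo (0 : ℝ) 1,
        (∀ v, 0 ≤ F ε v) ∧ (∫ v, F ε v ∂(sphereUniform N)) = 1 ∧
        ∃ c : ℝ, F ε =
          fun v => c * (sphereCap N hN ε).indicator (fun _ => (1 : ℝ)) v) ∧
      Tendsto (fun ε =>
          (∑ j, ∫ v, ((sphereUniform N)[F ε | coordSigma N j]) v *
              Real.log (((sphereUniform N)[F ε | coordSigma N j]) v) ∂(sphereUniform N)) /
            (∫ v, F ε v * Real.log (F ε v) ∂(sphereUniform N)))
        (nhdsWithin 0 (Set.Ioi 0)) (nhds 2) := by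
  obtain ⟨m, rfl⟩ := Nat.exists_eq_add_of_le' hN
  refine ⟨capDensity (m + 2) hN, fun ε hε => ⟨capDensity_nonneg _ _ _,
    integral_capDensity m hN hε.1, _, rfl⟩, ?_⟩
  obtain ⟨K, hK⟩ := entropy_condExp_capDensity_bounds m hN
  have hL : Tendsto (fun ε => -Real.log ε) (nhdsWithin 0 (Set.Ioi 0)) atTop :=
    tendsto_neg_atBot_atTop.comp Real.tendsto_log_nhdsGT_zero
  have hev : ∀ᶠ ε in nhdsWithin (0 : ℝ) (Set.Ioi 0), ε ∈ Set.Ioc (0 : ℝ) (1 / 2) :=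
    Ioc_mem_nhdsGT (by norm_num)
  have hS := tendsto_div_of_abs_sub_le hL (hev.mono fun ε hε => (hK ε hε).1)
  have hSj : ∀ j : Fin (m + 1), _ := fun j =>
    tendsto_div_of_abs_sub_le hL (hev.mono fun ε hε => (hK ε hε).2 j.succ (Fin.succ_ne_zero j))
  have hm : (m + 1 : ℝ) ≠ 0 := by positivity
  have hlim := (hS.add (tendsto_finsetSum Finset.univ fun j _ => hSj j)).div hS hm
  have h2 : ((m + 1 : ℝ) + ∑ _j : Fin (m + 1), 1) / (m + 1) = 2 := by
    simp; field_simp; norm_num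
  rw [h2] at hlim
  refine hlim.congr' ?_
  filter_upwards [hev, hL.eventually_gt_atTop 0] with ε hε hpos
  rw [Fin.sum_univ_succ, condExp_capDensity_zero m hN hε.1]
  simp only [Pi.div_apply]
  rw [← Finset.sum_div, ← add_div, div_div_div_cancel_right₀ hpos.ne']
end

section
/- Brascamp–Lieb via heat flow: let a_1,...,a_N span ℝ^M, p_j ∈ [1,∞], and suppose the Gaussian variational problem D_G(p) = sup over centered Gaussians g_j of ∫_{ℝ^M} ∏ g_j(a_j·x) dx / ∏ ‖g_j‖_{p_j} attains its supremum. Then D(p) = D_G(p), where D(p) is the analogous supremum over all nonnegative f_j ∈ L^{p_j}(ℝ). -/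
open MeasureTheory ENNReal

/-- The ratio `∫ ∏_j f_j(a_j·x) dx / ∏_j ‖f_j‖_{p_j}` of the Brascamp–Lieb
variational problem. -/
noncomputable def BLratio (M N : ℕ) (a : Fin N → Fin M → ℝ) (p : Fin N → ℝ≥0∞)
    (f : Fin N → ℝ → ℝ) : ℝ≥0∞ :=
  (∫⁻ x : Fin M → ℝ, ∏ j, ENNReal.ofReal (f j (∑ m, a j m * x m))) /
    ∏ j, eLpNorm (f j) (p j) volume

/-- The Brascamp–Lieb constant `D(p)`: supremum of the ratio over all nonnegative
measurable functions. -/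
noncomputable def BLconst (M N : ℕ) (a : Fin N → Fin M → ℝ) (p : Fin N → ℝ≥0∞) :
    ℝ≥0∞ :=
  ⨆ (f : Fin N → ℝ → ℝ) (_ : ∀ j, Measurable (f j) ∧ ∀ x, 0 ≤ f j x),
    BLratio M N a p f

/-- The Gaussian Brascamp–Lieb constant `D_G(p)`: supremum of the ratio over all
centered Gaussians `g_j(y) = c_j e^{-(s_j y)²/2}`. -/
noncomputable def BLGaussConst (M N : ℕ) (a : Fin N → Fin M → ℝ)
    (p : Fin N → ℝ≥0∞) : ℝ≥0∞ :=
  ⨆ (c : Fin N → ℝ) (s : Fin N → ℝ) (_ : ∀ j, 0 < c j ∧ 0 < s j),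
    BLratio M N a p (fun j y => c j * Real.exp (-(s j * y) ^ 2 / 2))

section

open Set Filter Topology

/-- Monotone transport on the line between two densities of equal total mass. -/
theorem exists_monotone_transport {h g : ℝ → ℝ} (hh : Continuous h) (hg : Continuous g)
    (hh0 : ∀ x, 0 < h x) (hg0 : ∀ x, 0 < g x) (hhi : Integrable h) (hgi : Integrable g)
    (heq : ∫ x, h x = ∫ x, g x) :
    ∃ T : ℝ → ℝ, StrictMono T ∧ ∀ x, HasDerivAt T (h x / g (T x)) x := by
  have key : ∀ f : ℝ → ℝ, Continuous f → (∀ x, 0 < f x) → Integrable f →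
      ∃ F : ℝ → ℝ, (∀ x, HasDerivAt F (f x) x) ∧ StrictMono F ∧
        Set.range F = Ioo 0 (∫ x, f x) := by
    intro f hf hf0 hfi
    set F : ℝ → ℝ := fun t => (∫ x in (0 : ℝ)..t, f x) + ∫ x in Iic (0 : ℝ), f x with hF
    have hd : ∀ x, HasDerivAt F (f x) x := fun x =>
      (hf.integral_hasStrictDerivAt 0 x).hasDerivAt.add_const _
    have hm : StrictMono F := strictMono_of_deriv_pos fun x => by
      rw [(hd x).deriv]; exact hf0 x
    have hFI : ∀ t, F t = ∫ x in Iic t, f x := fun t => by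
      rw [hF]
      simp only
      rw [← intervalIntegral.integral_Iic_sub_Iic hfi.integrableOn hfi.integrableOn]
      ring
    have hbot : Tendsto F atBot (𝓝 0) := by
      simp_rw [funext hFI]
      exact tendsto_integral_Iic_zero tendsto_id
    have htop : Tendsto F atTop (𝓝 (∫ x, f x)) := by
      have := (intervalIntegral_tendsto_integral_Ioi (0 : ℝ) hfi.integrableOn
        tendsto_id).add_const (∫ x in Iic (0 : ℝ), f x)
      rwa [add_comm, intervalIntegral.integral_Iic_add_Ioi hfi.integrableOn
        hfi.integrableOn] at this
    refine ⟨F, hd, hm, Subset.antisymm ?_ ?_⟩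
    · rintro _ ⟨x, rfl⟩
      constructor
      · exact (hm.monotone.le_of_tendsto hbot (x - 1)).trans_lt (hm (by linarith))
      · exact (hm (show x < x + 1 by linarith)).trans_le (hm.monotone.ge_of_tendsto htop (x + 1))
    · rintro y ⟨hy0, hy1⟩
      have hc : Continuous F := continuous_iff_continuousAt.2 fun x => (hd x).continuousAt
      obtain ⟨u, hu⟩ := (hbot.eventually_lt_const hy0).exists
      obtain ⟨v, hv⟩ := (htop.eventually_const_lt hy1).exists
      exact mem_range_of_exists_le_of_exists_ge hc ⟨u, hu.le⟩ ⟨v, hv.le⟩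
  obtain ⟨F, hFd, hFm, hFr⟩ := key h hh hh0 hhi
  obtain ⟨G, hGd, hGm, hGr⟩ := key g hg hg0 hgi
  rw [heq, ← hGr] at hFr
  have hex : ∀ t, ∃ u, G u = F t := fun t => by
    have : F t ∈ Set.range G := hFr ▸ mem_range_self t
    exact this
  choose T hT using hex
  have hTm : StrictMono T := fun x y hxy => by
    rw [← hGm.lt_iff_lt, hT, hT]
    exact hFm hxy
  have hTs : Function.Surjective T := fun u => by
    have : G u ∈ Set.range F := hFr ▸ mem_range_self u
    obtain ⟨t, ht⟩ := this
    exact ⟨t, hGm.injective (by rw [hT, ht])⟩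
  have hTc : Continuous T := hTm.monotone.continuous_of_surjective hTs
  exact ⟨T, hTm, fun x => HasDerivAt.of_comp_left hTc.continuousAt (hGd _) (hFd x) (hg0 _).ne'
    (Eventually.of_forall hT)⟩

open Matrix in
theorem Matrix.dotProduct_transpose_mul_diagonal_mul_mulVec {ι κ : Type*} [Fintype ι] [Fintype κ]
    [DecidableEq κ] (a : Matrix κ ι ℝ) (w : κ → ℝ) (x : ι → ℝ) :
    x ⬝ᵥ ((aᵀ * diagonal w * a) *ᵥ x) = ∑ j, w j * (a *ᵥ x) j ^ 2 := by
  rw [Matrix.mul_assoc, ← mulVec_mulVec, dotProduct_mulVec, vecMul_transpose, ← mulVec_mulVec]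
  simp only [dotProduct, mulVec_diagonal]
  exact Finset.sum_congr rfl fun j _ => by ring

open Matrix in
theorem Matrix.posDef_transpose_mul_diagonal_mul {ι κ : Type*} [Fintype ι] [Fintype κ]
    [DecidableEq κ] {a : Matrix κ ι ℝ} (ha : Function.Injective a.mulVec) {w : κ → ℝ}
    (hw : ∀ j, 0 < w j) : (aᵀ * diagonal w * a).PosDef := by
  have := (PosDef.diagonal (R := ℝ) hw).conjTranspose_mul_mul_same ha
  rwa [conjTranspose_eq_transpose_of_trivial] at this

/-- The integral of the standard Gaussian `exp (-|x|² / 2)` over `ι → ℝ`. -/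
noncomputable def stdGaussianLIntegral (ι : Type*) [Fintype ι] : ℝ≥0∞ :=
  ∫⁻ x : ι → ℝ, ENNReal.ofReal (Real.exp (-(x ⬝ᵥ x) / 2))

theorem stdGaussianLIntegral_ne_zero (ι : Type*) [Fintype ι] : stdGaussianLIntegral ι ≠ 0 := by
  rw [stdGaussianLIntegral, ← pos_iff_ne_zero,
    lintegral_pos_iff_support (by unfold dotProduct; fun_prop)]
  have : (Function.support fun x : ι → ℝ => ENNReal.ofReal (Real.exp (-(x ⬝ᵥ x) / 2)))
      = Set.univ := by
    ext x; simp [Real.exp_pos]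
  rw [this]
  exact isOpen_univ.measure_pos _ Set.univ_nonempty

theorem stdGaussianLIntegral_ne_top (ι : Type*) [Fintype ι] : stdGaussianLIntegral ι ≠ ∞ := by
  have h : Integrable (fun x : ι → ℝ => ∏ i, Real.exp (-(1 / 2) * x i ^ 2)) :=
    Integrable.fintype_prod fun _ => integrable_exp_neg_mul_sq (by norm_num)
  have := h.lintegral_lt_top
  refine (this.trans_eq' ?_).ne
  unfold stdGaussianLIntegral
  congr with x
  rw [← Real.exp_sum]
  congr 2
  simp only [dotProduct, neg_div, Finset.sum_div, ← Finset.sum_neg_distrib]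
  exact Finset.sum_congr rfl fun j _ => by ring

open Matrix in
open scoped MatrixOrder Matrix.Norms.L2Operator in
theorem Matrix.PosDef.lintegral_exp_neg {ι : Type*} [Fintype ι] [DecidableEq ι]
    {A : Matrix ι ι ℝ} (hA : A.PosDef) :
    ∫⁻ x : ι → ℝ, ENNReal.ofReal (Real.exp (-(x ⬝ᵥ (A *ᵥ x)) / 2)) =
      ENNReal.ofReal (√A.det)⁻¹ * stdGaussianLIntegral ι := by
  obtain ⟨B, hB⟩ := CStarAlgebra.nonneg_iff_eq_star_mul_self.mp hA.posSemidef.nonneg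
  rw [star_eq_conjTranspose, conjTranspose_eq_transpose_of_trivial] at hB
  have hdet : A.det = B.det ^ 2 := by rw [hB, det_mul, det_transpose, sq]
  have hB0 : B.det ≠ 0 := fun h => by simp [h, hA.det_pos.ne'] at hdet
  have hlin : LinearMap.det (toLin' B) ≠ 0 := by rwa [LinearMap.det_toLin']
  have hmap := Real.map_linearMap_volume_pi_eq_smul_volume_pi hlin
  have hm : Measurable (toLin' B) := (LinearMap.continuous_of_finiteDimensional _).measurable
  have hg : Measurable fun y : ι → ℝ => ENNReal.ofReal (Real.exp (-(y ⬝ᵥ y) / 2)) := by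
    unfold dotProduct; fun_prop
  calc _ = ∫⁻ x : ι → ℝ, ENNReal.ofReal (Real.exp (-(toLin' B x ⬝ᵥ toLin' B x) / 2)) := by
        congr with x
        rw [hB, ← mulVec_mulVec, dotProduct_mulVec, vecMul_transpose, toLin'_apply]
    _ = ∫⁻ y, ENNReal.ofReal (Real.exp (-(y ⬝ᵥ y) / 2)) ∂(volume.map (toLin' B)) :=
        (lintegral_map hg hm).symm
    _ = _ := by
        rw [hmap, lintegral_smul_measure, hdet, Real.sqrt_sq_eq_abs, LinearMap.det_toLin', abs_inv]
        rfl

theorem eLpNorm_comp_mul_left {f : ℝ → ℝ} (p : ℝ≥0∞) {r : ℝ} (hr : 0 < r) :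
    eLpNorm (fun y => f (r * y)) p volume =
      ENNReal.ofReal (r ^ (-(1 / p.toReal))) * eLpNorm f p volume := by
  have he : MeasurableEmbedding (fun y : ℝ => r * y) :=
    (Homeomorph.mulLeft₀ r hr.ne').measurableEmbedding
  have := he.eLpNorm_map_measure (g := f) (p := p) (μ := volume)
  rw [Real.map_volume_mul_left hr.ne',
    eLpNorm_smul_measure_of_ne_zero (by simpa using hr.ne')] at this
  rw [abs_of_pos (inv_pos.2 hr), ENNReal.ofReal_rpow_of_pos (inv_pos.2 hr), smul_eq_mul] at this
  rw [Real.rpow_neg hr.le, ← Real.inv_rpow hr.le]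
  simpa [Function.comp_def] using this.symm

theorem memLp_exp_neg_sq {s : ℝ} (hs : 0 < s) (p : ℝ≥0∞) :
    MemLp (fun y : ℝ => Real.exp (-(s * y) ^ 2 / 2)) p volume := by
  have hm : AEStronglyMeasurable (fun y : ℝ => Real.exp (-(s * y) ^ 2 / 2)) volume := by fun_prop
  by_cases h0 : p = 0
  · rw [h0]; exact memLp_zero_iff_aestronglyMeasurable.2 hm
  by_cases ht : p = ∞
  · rw [ht]
    refine memLp_top_of_bound hm 1 (ae_of_all _ fun y => ?_)
    rw [Real.norm_eq_abs, Real.abs_exp]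
    exact Real.exp_le_one_iff.2 (by nlinarith [sq_nonneg (s * y)])
  · rw [← integrable_norm_rpow_iff hm h0 ht]
    have hp : 0 < p.toReal := ENNReal.toReal_pos h0 ht
    refine (integrable_exp_neg_mul_sq (b := p.toReal * s ^ 2 / 2) (by positivity)).congr
      (ae_of_all _ fun y => ?_)
    simp only [Real.norm_eq_abs, Real.abs_exp]
    rw [← Real.exp_mul]
    congr 1
    ring

theorem eLpNorm_exp_neg_sq_ne_zero (s : ℝ) {p : ℝ≥0∞} (hp : p ≠ 0) :
    eLpNorm (fun y : ℝ => Real.exp (-(s * y) ^ 2 / 2)) p volume ≠ 0 := by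
  rw [Ne, eLpNorm_eq_zero_iff (by fun_prop) hp]
  intro h
  obtain ⟨x, hx⟩ := h.exists
  exact (Real.exp_pos _).ne' hx

open Matrix in
theorem Matrix.transpose_mul_diagonal_mul_apply {ι κ : Type*} [Fintype κ]
    [DecidableEq κ] (a : Matrix κ ι ℝ) (w : κ → ℝ) (m n : ι) :
    (aᵀ * diagonal w * a) m n = ∑ j, w j * a j m * a j n := by
  rw [Matrix.mul_apply]
  exact Finset.sum_congr rfl fun j _ => by rw [mul_diagonal, transpose_apply, mul_comm (a j m)]

open Matrix in
theorem Matrix.injective_mulVec_of_span_range_eq_top {ι κ : Type*} [Fintype ι] [DecidableEq ι]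
    {a : κ → ι → ℝ}
    (hspan : Submodule.span ℝ (range a) = ⊤) : Function.Injective (Matrix.of a).mulVec := by
  intro x y hxy
  have hker : (⊤ : Submodule ℝ (ι → ℝ)) ≤ LinearMap.ker (dotProductBilin ℝ ℝ (x - y)) := by
    rw [← hspan, Submodule.span_le]
    rintro _ ⟨j, rfl⟩
    have := congrFun hxy j
    simp only [mulVec, of_apply] at this
    simp [dotProductBilin, sub_dotProduct, dotProduct_comm x, dotProduct_comm y, this]
  have : (x - y) ⬝ᵥ (x - y) = 0 := by
    exact hker (Submodule.mem_top (x := x - y))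
  exact sub_eq_zero.1 (dotProduct_self_eq_zero.1 this)

open Matrix in
theorem prod_exp_neg_sq {ι κ : Type*} [Fintype ι] [Fintype κ] [DecidableEq κ]
    (a : Matrix κ ι ℝ) (s : κ → ℝ) (x : ι → ℝ) :
    ∏ j, Real.exp (-(s j * (a *ᵥ x) j) ^ 2 / 2) =
      Real.exp (-(x ⬝ᵥ ((aᵀ * diagonal (fun j => s j ^ 2) * a) *ᵥ x)) / 2) := by
  rw [dotProduct_transpose_mul_diagonal_mul_mulVec, ← Real.exp_sum, neg_div, Finset.sum_div,
    ← Finset.sum_neg_distrib]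
  congr 1
  exact Finset.sum_congr rfl fun j _ => by ring

open Matrix in
theorem lintegral_prod_exp_neg_sq {M N : ℕ} {a : Fin N → Fin M → ℝ}
    (hspan : Submodule.span ℝ (range a) = ⊤) {s : Fin N → ℝ} (hs : ∀ j, 0 < s j) :
    ∫⁻ x : Fin M → ℝ, ∏ j, ENNReal.ofReal (Real.exp (-(s j * ∑ m, a j m * x m) ^ 2 / 2)) =
      ENNReal.ofReal (√((of a)ᵀ * diagonal (fun j => s j ^ 2) * of a).det)⁻¹ *
        stdGaussianLIntegral (Fin M) := by
  rw [← (posDef_transpose_mul_diagonal_mul (injective_mulVec_of_span_range_eq_top hspan)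
    fun j => pow_pos (hs j) 2).lintegral_exp_neg]
  congr with x
  rw [← ENNReal.ofReal_prod_of_nonneg fun _ _ => (Real.exp_pos _).le, ← prod_exp_neg_sq]
  rfl

theorem BLratio_exp_le_BLGaussConst {M N : ℕ} {a : Fin N → Fin M → ℝ} {p : Fin N → ℝ≥0∞}
    {s : Fin N → ℝ} (hs : ∀ j, 0 < s j) :
    BLratio M N a p (fun j y => Real.exp (-(s j * y) ^ 2 / 2)) ≤ BLGaussConst M N a p := by
  refine le_iSup_of_le (fun _ => 1) (le_iSup_of_le s (le_iSup_of_le (fun j => ⟨one_pos, hs j⟩) ?_))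
  simp

open Matrix in
/-- Comparing a Gaussian maximizer with the Gaussians `exp (-s_j² t_j y² / 2)` gives a
determinant inequality in the weights `t_j`. -/
theorem prod_rpow_mul_det_le_of_gaussian_maximizer {M N : ℕ} {a : Fin N → Fin M → ℝ}
    (hspan : Submodule.span ℝ (range a) = ⊤) {p : Fin N → ℝ≥0∞} (hp : ∀ j, 1 ≤ p j)
    {s : Fin N → ℝ} (hs : ∀ j, 0 < s j)
    (hmax : BLratio M N a p (fun j y => Real.exp (-(s j * y) ^ 2 / 2)) = BLGaussConst M N a p)
    {t : Fin N → ℝ} (ht : ∀ j, 0 < t j) :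
    (∏ j, t j ^ (1 / (p j).toReal)) *
        ((of a)ᵀ * diagonal (fun j => s j ^ 2) * of a).det ≤
      ((of a)ᵀ * diagonal (fun j => s j ^ 2 * t j) * of a).det := by
  have hr : ∀ j, 0 < √(t j) := fun j => Real.sqrt_pos.2 (ht j)
  have hs' : ∀ j, 0 < s j * √(t j) := fun j => mul_pos (hs j) (hr j)
  have hinj := injective_mulVec_of_span_range_eq_top hspan
  have hp0 : ∀ j, p j ≠ 0 := fun j => (one_pos.trans_le (hp j)).ne'
  have key := (BLratio_exp_le_BLGaussConst (a := a) (p := p) hs').trans_eq hmax.symm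
  unfold BLratio at key
  rw [lintegral_prod_exp_neg_sq hspan hs, lintegral_prod_exp_neg_sq hspan hs'] at key
  have hsq : (fun j => (s j * √(t j)) ^ 2) = fun j => s j ^ 2 * t j :=
    funext fun j => by rw [mul_pow, Real.sq_sqrt (ht j).le]
  rw [hsq] at key
  have hd1 := (posDef_transpose_mul_diagonal_mul hinj fun j => pow_pos (hs j) 2).det_pos
  have hd2 := (posDef_transpose_mul_diagonal_mul hinj
    fun j => mul_pos (pow_pos (hs j) 2) (ht j)).det_pos
  set d1 := ((of a)ᵀ * diagonal (fun j => s j ^ 2) * of a).det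
  set d2 := ((of a)ᵀ * diagonal (fun j => s j ^ 2 * t j) * of a).det
  set n : ℝ≥0∞ := ∏ j, eLpNorm (fun y => Real.exp (-(s j * y) ^ 2 / 2)) (p j) volume with hn
  have hn0 : n ≠ 0 := Finset.prod_ne_zero_iff.2 fun j _ => eLpNorm_exp_neg_sq_ne_zero _ (hp0 j)
  have hnt : n ≠ ∞ := ENNReal.prod_ne_top fun j _ => (memLp_exp_neg_sq (hs j) _).eLpNorm_ne_top
  set R := ∏ j, √(t j) ^ (1 / (p j).toReal) with hR
  have hRpos : 0 < R := Finset.prod_pos fun j _ => Real.rpow_pos_of_pos (hr j) _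
  have hn' : ∏ j, eLpNorm (fun y => Real.exp (-(s j * √(t j) * y) ^ 2 / 2)) (p j) volume =
      ENNReal.ofReal R⁻¹ * n := by
    rw [hR, ← Finset.prod_inv_distrib,
      ENNReal.ofReal_prod_of_nonneg fun j _ => (inv_pos.2 (Real.rpow_pos_of_pos (hr j) _)).le, hn,
      ← Finset.prod_mul_distrib]
    refine Finset.prod_congr rfl fun j _ => ?_
    rw [← Real.rpow_neg (hr j).le, ← eLpNorm_comp_mul_left (p j) (hr j)]
    simp only [mul_assoc]
  rw [hn', ENNReal.div_le_iff (by simp [hn0, hRpos]) (ENNReal.mul_ne_top ofReal_ne_top hnt),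
    mul_left_comm, ENNReal.div_mul_cancel hn0 hnt, ← mul_assoc,
    ENNReal.mul_le_mul_iff_left (stdGaussianLIntegral_ne_zero _) (stdGaussianLIntegral_ne_top _),
    ← ENNReal.ofReal_mul (by positivity), ENNReal.ofReal_le_ofReal_iff (by positivity),
    ← mul_inv, inv_le_inv₀ (by positivity) (by positivity)] at key
  have hR2 : R ^ 2 = ∏ j, t j ^ (1 / (p j).toReal) := by
    rw [hR, ← Finset.prod_pow]
    refine Finset.prod_congr rfl fun j _ => ?_
    rw [← Real.rpow_natCast, ← Real.rpow_mul (hr j).le, mul_comm, Real.rpow_mul (hr j).le,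
      Real.rpow_natCast, Real.sq_sqrt (ht j).le]
  have := pow_le_pow_left₀ (by positivity) key 2
  rwa [mul_pow, Real.sq_sqrt hd1.le, Real.sq_sqrt hd2.le, hR2] at this

open Matrix in
theorem ne_top_of_gaussian_maximizer {M N : ℕ} {a : Fin N → Fin M → ℝ} (ha : ∀ j, a j ≠ 0)
    (hspan : Submodule.span ℝ (range a) = ⊤) {p : Fin N → ℝ≥0∞} (hp : ∀ j, 1 ≤ p j)
    {s : Fin N → ℝ} (hs : ∀ j, 0 < s j)
    (hmax : BLratio M N a p (fun j y => Real.exp (-(s j * y) ^ 2 / 2)) = BLGaussConst M N a p)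
    (j : Fin N) : p j ≠ ∞ := by
  intro hj
  have hinj := injective_mulVec_of_span_range_eq_top hspan
  have ht : ∀ i, 0 < Function.update (fun _ : Fin N => (1 : ℝ)) j (1 / 2) i := fun i => by
    rcases eq_or_ne i j with rfl | h <;> simp [*]
  have key := prod_rpow_mul_det_le_of_gaussian_maximizer hspan hp hs hmax ht
  have h1 : ∏ i, Function.update (fun _ : Fin N => (1 : ℝ)) j (1 / 2) i ^ (1 / (p i).toReal) = 1 :=
    Finset.prod_eq_one fun i _ => by rcases eq_or_ne i j with rfl | h <;> simp [*]
  rw [h1, one_mul] at key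
  set B := (of a)ᵀ *
    diagonal (fun i => s i ^ 2 * Function.update (fun _ : Fin N => (1 : ℝ)) j (1 / 2) i) * of a
    with hB
  have hBpos : B.PosDef := posDef_transpose_mul_diagonal_mul hinj
    fun i => mul_pos (pow_pos (hs i) 2) (ht i)
  have hA : (of a)ᵀ * diagonal (fun i => s i ^ 2) * of a =
      B + replicateCol Unit ((s j ^ 2 / 2) • a j) * replicateRow Unit (a j) := by
    ext m n
    have hrow : (replicateCol Unit ((s j ^ 2 / 2) • a j) * replicateRow Unit (a j) :
        Matrix (Fin M) (Fin M) ℝ) m n =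
        ∑ i, if i = j then s j ^ 2 / 2 * a j m * a j n else 0 := by
      simp [Matrix.mul_apply]
    rw [Matrix.add_apply, hB, hrow, transpose_mul_diagonal_mul_apply,
      transpose_mul_diagonal_mul_apply, ← Finset.sum_add_distrib]
    refine Finset.sum_congr rfl fun i _ => ?_
    rcases eq_or_ne i j with rfl | h
    · simp only [Function.update_self, if_true, of_apply]; ring
    · simp [h]
  have hq : 0 < a j ⬝ᵥ (B⁻¹ *ᵥ a j) := by
    simpa using hBpos.inv.dotProduct_mulVec_pos (ha j)
  have hdet : (1 + replicateRow Unit (a j) * B⁻¹ * replicateCol Unit ((s j ^ 2 / 2) • a j)).det =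
      1 + s j ^ 2 / 2 * (a j ⬝ᵥ (B⁻¹ *ᵥ a j)) := by
    rw [det_unique, Matrix.add_apply, Matrix.one_apply_eq, Matrix.mul_assoc,
      ← replicateCol_mulVec, replicateRow_mul_replicateCol_apply, mulVec_smul, dotProduct_smul,
      smul_eq_mul]
  rw [hA, det_add_replicateCol_mul_replicateRow hBpos.det_pos.ne'.isUnit, hdet] at key
  nlinarith [hBpos.det_pos, mul_pos hBpos.det_pos (mul_pos (pow_pos (hs j) 2) hq)]

theorem exists_monotone_transport_rpow {f g : ℝ → ℝ} (hf : Continuous f) (hg : Continuous g)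
    (hf0 : ∀ x, 0 < f x) (hg0 : ∀ x, 0 < g x) {p : ℝ≥0∞} (hp0 : p ≠ 0) (hpt : p ≠ ∞)
    (hfp : MemLp f p) (hgp : MemLp g p) :
    ∃ (T T' : ℝ → ℝ) (κ : ℝ), StrictMono T ∧ (∀ x, HasDerivAt T (T' x) x) ∧ (∀ x, 0 < T' x) ∧
      0 < κ ∧ (∀ x, f x = κ * (g (T x) * T' x ^ (1 / p.toReal))) ∧
      ENNReal.ofReal κ * eLpNorm g p volume = eLpNorm f p volume := by
  have hq : 0 < p.toReal := ENNReal.toReal_pos hp0 hpt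
  set q := p.toReal with hqdef
  have key : ∀ u : ℝ → ℝ, Continuous u → (∀ x, 0 < u x) → MemLp u p →
      Continuous (fun x => u x ^ q) ∧ Integrable (fun x => u x ^ q) ∧ 0 < ∫ x, u x ^ q ∧
        eLpNorm u p volume = ENNReal.ofReal ((∫ x, u x ^ q) ^ (1 / q)) := by
    intro u hu hu0 hup
    have hc : Continuous fun x => u x ^ q := hu.rpow_const fun x => Or.inl (hu0 x).ne'
    have hn : ∀ x, ‖u x‖ = u x := fun x => by rw [Real.norm_eq_abs, abs_of_pos (hu0 x)]
    have hi : Integrable fun x => u x ^ q := by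
      simpa only [hn] using hup.integrable_norm_rpow hp0 hpt
    refine ⟨hc, hi, ?_, ?_⟩
    · rw [integral_pos_iff_support_of_nonneg (fun x => (Real.rpow_pos_of_pos (hu0 x) q).le) hi]
      have : (Function.support fun x => u x ^ q) = univ := by
        ext x; simp [(Real.rpow_pos_of_pos (hu0 x) q).ne']
      simp [this]
    · rw [hup.eLpNorm_eq_integral_rpow_norm hp0 hpt]
      simp only [hn, one_div, hqdef]
  obtain ⟨hfc, hfi, hF, hfn⟩ := key f hf hf0 hfp
  obtain ⟨hgc, hgi, hG, hgn⟩ := key g hg hg0 hgp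
  set F := ∫ x, f x ^ q
  set G := ∫ x, g x ^ q
  have hfq : ∀ x, 0 < f x ^ q := fun x => Real.rpow_pos_of_pos (hf0 x) q
  have hgq : ∀ x, 0 < g x ^ q := fun x => Real.rpow_pos_of_pos (hg0 x) q
  obtain ⟨T, hTm, hT⟩ := exists_monotone_transport (h := fun x => G / F * f x ^ q)
    (g := fun x => g x ^ q) (hfc.const_mul _) hgc (fun x => mul_pos (div_pos hG hF) (hfq x)) hgq
    (hfi.const_mul _) hgi (by rw [integral_const_mul]; exact div_mul_cancel₀ _ hF.ne')
  have hT' : ∀ x, 0 < G / F * f x ^ q / g (T x) ^ q := fun x =>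
    div_pos (mul_pos (div_pos hG hF) (hfq x)) (hgq _)
  refine ⟨T, _, (F / G) ^ (1 / q), hTm, hT, hT', Real.rpow_pos_of_pos (div_pos hF hG) _,
    fun x => ?_, ?_⟩
  · have h1 : ∀ y : ℝ, 0 < y → y = (y ^ q) ^ (1 / q) := fun y hy => by
      rw [one_div, Real.rpow_rpow_inv hy.le hq.ne']
    have h2 : g (T x) * (G / F * f x ^ q / g (T x) ^ q) ^ (1 / q) =
        (g (T x) ^ q * (G / F * f x ^ q / g (T x) ^ q)) ^ (1 / q) := by
      rw [Real.mul_rpow (hgq _).le (hT' x).le, ← h1 _ (hg0 _)]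
    rw [h2, ← Real.mul_rpow (div_pos hF hG).le (mul_pos (hgq _) (hT' x)).le]
    conv_lhs => rw [h1 (f x) (hf0 _)]
    congr 1
    have := (hgq (T x)).ne'
    field_simp
  · rw [hfn, hgn, ← ENNReal.ofReal_mul (Real.rpow_pos_of_pos (div_pos hF hG) _).le,
      ← Real.mul_rpow (div_pos hF hG).le hG.le, div_mul_cancel₀ _ hG.ne']

open Matrix in
theorem Matrix.dotProduct_mulVec_weighted_leastSquares_le {ι κ : Type*} [Fintype ι] [Fintype κ]
    [DecidableEq ι] [DecidableEq κ] {a : Matrix κ ι ℝ} {w : κ → ℝ} (hw : ∀ j, 0 ≤ w j)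
    (hdet : IsUnit (aᵀ * diagonal w * a).det) (u : κ → ℝ) {y : ι → ℝ}
    (hy : y = (aᵀ * diagonal w * a)⁻¹ *ᵥ (aᵀ *ᵥ fun j => w j * u j)) :
    y ⬝ᵥ ((aᵀ * diagonal w * a) *ᵥ y) ≤ ∑ j, w j * u j ^ 2 := by
  have h1 : y ⬝ᵥ ((aᵀ * diagonal w * a) *ᵥ y) = ∑ j, w j * u j * (a *ᵥ y) j := by
    have : (aᵀ * diagonal w * a) *ᵥ y = aᵀ *ᵥ fun j => w j * u j := by
      rw [hy, mulVec_mulVec, mul_nonsing_inv _ hdet, one_mulVec]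
    rw [this, dotProduct_mulVec, vecMul_transpose, dotProduct_comm]
    rfl
  have h2 := dotProduct_transpose_mul_diagonal_mul_mulVec a w y
  have h3 : 0 ≤ ∑ j, w j * (u j - (a *ᵥ y) j) ^ 2 :=
    Finset.sum_nonneg fun j _ => mul_nonneg (hw j) (sq_nonneg _)
  have h4 : ∑ j, w j * (u j - (a *ᵥ y) j) ^ 2 =
      ∑ j, w j * u j ^ 2 - 2 * ∑ j, w j * u j * (a *ᵥ y) j + ∑ j, w j * (a *ᵥ y) j ^ 2 := by
    rw [Finset.mul_sum, ← Finset.sum_sub_distrib, ← Finset.sum_add_distrib]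
    exact Finset.sum_congr rfl fun j _ => by ring
  linarith

open Matrix in
theorem Matrix.hasFDerivAt_mulVec_comp_mulVec {ι κ : Type*} [Fintype ι] [Fintype κ]
    [DecidableEq ι] [DecidableEq κ] (b : Matrix ι κ ℝ) (a : Matrix κ ι ℝ) {T : κ → ℝ → ℝ}
    {T' : κ → ℝ} {x : ι → ℝ} (hT : ∀ j, HasDerivAt (T j) (T' j) ((a *ᵥ x) j)) :
    HasFDerivAt (fun x => b *ᵥ fun j => T j ((a *ᵥ x) j))
      (LinearMap.toContinuousLinearMap (toLin' (b * diagonal T' * a))) x := by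
  have hΦ : HasFDerivAt (fun u : κ → ℝ => fun j => T j (u j))
      (ContinuousLinearMap.pi fun j =>
        T' j • ContinuousLinearMap.proj (R := ℝ) (φ := fun _ => ℝ) j) (a *ᵥ x) := by
    rw [hasFDerivAt_pi]
    intro j
    exact HasDerivAt.comp_hasFDerivAt (f := fun u : κ → ℝ => u j) (a *ᵥ x) (hT j)
      (ContinuousLinearMap.proj (R := ℝ) (φ := fun _ : κ => ℝ) j).hasFDerivAt
  have h1 : HasFDerivAt (fun x => a *ᵥ x) (LinearMap.toContinuousLinearMap (toLin' a)) x :=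
    (LinearMap.toContinuousLinearMap (toLin' a)).hasFDerivAt
  have h2 := (LinearMap.toContinuousLinearMap (toLin' b)).hasFDerivAt
    (x := fun j => T j ((a *ᵥ x) j))
  have h3 := h2.comp x (hΦ.comp x h1)
  refine h3.congr_fderiv (ContinuousLinearMap.ext fun v => ?_)
  have : ∀ u : κ → ℝ, (fun j => T' j * u j) = diagonal T' *ᵥ u := fun u => by
    ext j; rw [mulVec_diagonal]
  simp only [LinearMap.coe_toContinuousLinearMap', toLin'_apply, ContinuousLinearMap.comp_apply,
    ← mulVec_mulVec, ← this]
  rfl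

open Matrix in
/-- The Brascamp–Lieb inequality for continuous positive functions, by transporting each `f_j`
to the maximizing Gaussian and changing variables by a weighted least squares combination of
the transport maps. -/
theorem lintegral_prod_le_of_continuous {M N : ℕ} {a : Fin N → Fin M → ℝ}
    (hspan : Submodule.span ℝ (range a) = ⊤) {p : Fin N → ℝ≥0∞} (hp : ∀ j, 1 ≤ p j)
    {s : Fin N → ℝ} (hs : ∀ j, 0 < s j) (hpt : ∀ j, p j ≠ ∞)
    (hdet : ∀ t : Fin N → ℝ, (∀ j, 0 < t j) → (∏ j, t j ^ (1 / (p j).toReal)) *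
        ((of a)ᵀ * diagonal (fun j => s j ^ 2) * of a).det ≤
      ((of a)ᵀ * diagonal (fun j => s j ^ 2 * t j) * of a).det)
    {f : Fin N → ℝ → ℝ} (hf : ∀ j, Continuous (f j)) (hf0 : ∀ j x, 0 < f j x)
    (hfp : ∀ j, MemLp (f j) (p j)) :
    ∫⁻ x : Fin M → ℝ, ∏ j, ENNReal.ofReal (f j (∑ m, a j m * x m)) ≤
      BLratio M N a p (fun j y => Real.exp (-(s j * y) ^ 2 / 2)) *
        ∏ j, eLpNorm (f j) (p j) volume := by
  have hinj := injective_mulVec_of_span_range_eq_top hspan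
  have hs2 : ∀ j, 0 < s j ^ 2 := fun j => pow_pos (hs j) 2
  have hp0 : ∀ j, p j ≠ 0 := fun j => (one_pos.trans_le (hp j)).ne'
  choose T T' κ hTm hT hT' hκ hfT hnorm using fun j =>
    exists_monotone_transport_rpow (hf j)
      (g := fun y => Real.exp (-(s j * y) ^ 2 / 2)) (by fun_prop) (hf0 j)
      (fun _ => Real.exp_pos _) (hp0 j) (hpt j) (hfp j) (memLp_exp_neg_sq (hs j) _)
  set A := (of a)ᵀ * diagonal (fun j => s j ^ 2) * of a with hA
  have hApos : A.det > 0 := (posDef_transpose_mul_diagonal_mul hinj hs2).det_pos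
  have hAu : IsUnit A.det := hApos.ne'.isUnit
  set φ : (Fin M → ℝ) → ℝ≥0∞ := fun y => ENNReal.ofReal (Real.exp (-(y ⬝ᵥ (A *ᵥ y)) / 2))
  set Y : (Fin M → ℝ) → Fin M → ℝ :=
    fun x => (A⁻¹ * (of a)ᵀ) *ᵥ fun j => s j ^ 2 * T j ((of a *ᵥ x) j) with hY
  set B : (Fin M → ℝ) → Matrix (Fin M) (Fin M) ℝ := fun x =>
    (of a)ᵀ * diagonal (fun j => s j ^ 2 * T' j ((of a *ᵥ x) j)) * of a with hB
  have hYd : ∀ x, HasFDerivAt Y (LinearMap.toContinuousLinearMap (toLin' (A⁻¹ * B x))) x := by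
    intro x
    have := hasFDerivAt_mulVec_comp_mulVec (A⁻¹ * (of a)ᵀ) (of a) (x := x)
      fun j => (hT j ((of a *ᵥ x) j)).const_mul (s j ^ 2)
    simpa only [hB, Matrix.mul_assoc] using this
  have hYi : Function.Injective Y := by
    intro x y hxy
    have h1 : (of a)ᵀ *ᵥ (fun j => s j ^ 2 * T j ((of a *ᵥ x) j)) =
        (of a)ᵀ *ᵥ (fun j => s j ^ 2 * T j ((of a *ᵥ y) j)) := by
      have := congrArg (A *ᵥ ·) hxy
      simpa only [hY, mulVec_mulVec, ← Matrix.mul_assoc, mul_nonsing_inv _ hAu, Matrix.one_mul]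
        using this
    have h2 : ∑ j, s j ^ 2 * ((T j ((of a *ᵥ x) j) - T j ((of a *ᵥ y) j)) *
        ((of a *ᵥ x) j - (of a *ᵥ y) j)) = 0 := by
      have h3 := congrArg ((x - y) ⬝ᵥ ·) h1
      simp only [dotProduct_mulVec, vecMul_transpose, mulVec_sub] at h3
      rw [← sub_eq_zero, ← dotProduct_sub] at h3
      rw [← h3, dotProduct]
      exact Finset.sum_congr rfl fun j _ => by simp only [Pi.sub_apply]; ring
    have h4 : ∀ j, 0 ≤ s j ^ 2 * ((T j ((of a *ᵥ x) j) - T j ((of a *ᵥ y) j)) *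
        ((of a *ᵥ x) j - (of a *ᵥ y) j)) := fun j => by
      refine mul_nonneg (hs2 j).le ?_
      rcases le_total ((of a *ᵥ x) j) ((of a *ᵥ y) j) with h | h
      · exact mul_nonneg_of_nonpos_of_nonpos (sub_nonpos.2 ((hTm j).monotone h)) (sub_nonpos.2 h)
      · exact mul_nonneg (sub_nonneg.2 ((hTm j).monotone h)) (sub_nonneg.2 h)
    refine hinj (funext fun j => ?_)
    have h5 := (Finset.sum_eq_zero_iff_of_nonneg fun j _ => h4 j).1 h2 j (Finset.mem_univ j)
    rcases mul_eq_zero.1 ((mul_eq_zero.1 h5).resolve_left (hs2 j).ne') with h | h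
    · exact (hTm j).injective (sub_eq_zero.1 h)
    · exact sub_eq_zero.1 h
  have hbound : ∀ x : Fin M → ℝ, ∏ j, ENNReal.ofReal (f j (∑ m, a j m * x m)) ≤
      ENNReal.ofReal (∏ j, κ j) * (ENNReal.ofReal
        |(LinearMap.toContinuousLinearMap (toLin' (A⁻¹ * B x))).det| * φ (Y x)) := by
    intro x
    rw [← ENNReal.ofReal_prod_of_nonneg fun j _ => (hf0 j _).le, ← ENNReal.ofReal_mul
      (abs_nonneg _), ← ENNReal.ofReal_mul (Finset.prod_nonneg fun j _ => (hκ j).le)]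
    refine ENNReal.ofReal_le_ofReal ?_
    have hprod : ∏ j, f j (∑ m, a j m * x m) = (∏ j, κ j) *
        ((∏ j, T' j ((of a *ᵥ x) j) ^ (1 / (p j).toReal)) *
          Real.exp (-(∑ j, s j ^ 2 * T j ((of a *ᵥ x) j) ^ 2) / 2)) := by
      rw [neg_div, Finset.sum_div, ← Finset.sum_neg_distrib, Real.exp_sum,
        ← Finset.prod_mul_distrib, ← Finset.prod_mul_distrib]
      refine Finset.prod_congr rfl fun j _ => ?_
      change f j ((of a *ᵥ x) j) = _
      rw [hfT j]
      have : -(s j * T j ((of a *ᵥ x) j)) ^ 2 / 2 = -(s j ^ 2 * T j ((of a *ᵥ x) j) ^ 2 / 2) := by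
        ring
      rw [this]
      ring
    rw [hprod]
    refine mul_le_mul_of_nonneg_left (mul_le_mul ?_ ?_ (Real.exp_pos _).le (abs_nonneg _))
      (Finset.prod_nonneg fun j _ => (hκ j).le)
    · refine le_trans ?_ (le_abs_self _)
      have : (LinearMap.toContinuousLinearMap (toLin' (A⁻¹ * B x))).det = A.det⁻¹ * (B x).det := by
        rw [ContinuousLinearMap.det, LinearMap.coe_toContinuousLinearMap, LinearMap.det_toLin',
          det_mul, det_nonsing_inv, Ring.inverse_eq_inv']
      rw [this, inv_mul_eq_div, le_div_iff₀ hApos]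
      exact hdet _ fun j => hT' j _
    · refine Real.exp_le_exp.2 ?_
      have := dotProduct_mulVec_weighted_leastSquares_le (fun j => (hs2 j).le) hAu
        (fun j => T j ((of a *ᵥ x) j)) (y := Y x) (by rw [hY, mulVec_mulVec])
      linarith
  calc ∫⁻ x : Fin M → ℝ, ∏ j, ENNReal.ofReal (f j (∑ m, a j m * x m))
      ≤ ENNReal.ofReal (∏ j, κ j) * ∫⁻ x, (ENNReal.ofReal
        |(LinearMap.toContinuousLinearMap (toLin' (A⁻¹ * B x))).det| * φ (Y x)) := by
        rw [← lintegral_const_mul' _ _ ofReal_ne_top]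
        exact lintegral_mono hbound
    _ = ENNReal.ofReal (∏ j, κ j) * ∫⁻ y in Y '' univ, φ y := by
        rw [lintegral_image_eq_lintegral_abs_det_fderiv_mul volume MeasurableSet.univ
          (fun x _ => (hYd x).hasFDerivWithinAt) hYi.injOn, Measure.restrict_univ]
    _ ≤ ENNReal.ofReal (∏ j, κ j) * ∫⁻ y, φ y := by
        gcongr
        exact Measure.restrict_le_self
    _ = _ := by
        have hnf : ∏ j, eLpNorm (f j) (p j) volume = ENNReal.ofReal (∏ j, κ j) *
            ∏ j, eLpNorm (fun y => Real.exp (-(s j * y) ^ 2 / 2)) (p j) volume := by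
          rw [ENNReal.ofReal_prod_of_nonneg fun j _ => (hκ j).le, ← Finset.prod_mul_distrib]
          exact Finset.prod_congr rfl fun j _ => (hnorm j).symm
        rw [BLratio, hnf, mul_left_comm, ENNReal.div_mul_cancel
          (Finset.prod_ne_zero_iff.2 fun j _ => eLpNorm_exp_neg_sq_ne_zero _ (hp0 j))
          (ENNReal.prod_ne_top fun j _ => (memLp_exp_neg_sq (hs j) _).eLpNorm_ne_top),
          lintegral_prod_exp_neg_sq hspan hs,
          (posDef_transpose_mul_diagonal_mul hinj hs2).lintegral_exp_neg]

theorem exists_continuous_pos_eLpNorm_sub_le {f : ℝ → ℝ} (hf0 : ∀ x, 0 ≤ f x) {p : ℝ≥0∞}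
    (hp : 1 ≤ p) (hpt : p ≠ ∞) (hfp : MemLp f p) {ε : ℝ≥0∞} (hε : ε ≠ 0) :
    ∃ g : ℝ → ℝ, Continuous g ∧ (∀ x, 0 < g x) ∧ MemLp g p ∧ eLpNorm (g - f) p volume ≤ ε := by
  obtain ⟨u, -, hu, huc, hup⟩ :=
    hfp.exists_hasCompactSupport_eLpNorm_sub_le hpt (ENNReal.half_pos hε).ne'
  set γ : ℝ → ℝ := fun y => Real.exp (-(1 * y) ^ 2 / 2)
  have hγp : MemLp γ p := memLp_exp_neg_sq one_pos p
  obtain ⟨δ, hδ0, hδ⟩ :=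
    ENNReal.exists_nnreal_pos_mul_lt hγp.eLpNorm_ne_top (ENNReal.half_pos hε).ne'
  have hδγ : ∀ x, 0 < (δ : ℝ) * γ x := fun x => mul_pos (NNReal.coe_pos.2 hδ0) (Real.exp_pos _)
  refine ⟨fun x => |u x| + δ * γ x, by fun_prop, fun x => ?_, ?_, ?_⟩
  · exact add_pos_of_nonneg_of_pos (abs_nonneg _) (hδγ x)
  · exact hup.abs.add (hγp.const_mul _)
  · calc eLpNorm ((fun x => |u x| + δ * γ x) - f) p volume
        ≤ eLpNorm ((fun x => ‖(f - u) x‖) + (δ : ℝ) • γ) p volume := by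
          refine eLpNorm_mono fun x => ?_
          simp only [Pi.sub_apply, Pi.add_apply, Pi.smul_apply, smul_eq_mul, Real.norm_eq_abs]
          rw [abs_of_pos (add_pos_of_nonneg_of_pos (abs_nonneg _) (hδγ x))]
          have h1 := abs_abs_sub_abs_le (u x) (f x)
          rw [abs_of_nonneg (hf0 x), abs_sub_comm (u x)] at h1
          calc |(|u x| + δ * γ x - f x)| = |(|u x| - f x) + δ * γ x| := by ring_nf
            _ ≤ |(|u x| - f x)| + |δ * γ x| := abs_add_le _ _
            _ ≤ |f x - u x| + δ * γ x := by rw [abs_of_pos (hδγ x)]; gcongr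
      _ ≤ eLpNorm (fun x => ‖(f - u) x‖) p volume + eLpNorm ((δ : ℝ) • γ) p volume :=
          eLpNorm_add_le (hfp.sub hup).aestronglyMeasurable.norm
            (hγp.const_smul (δ : ℝ)).aestronglyMeasurable hp
      _ ≤ ε / 2 + ε / 2 := by
          rw [eLpNorm_norm, eLpNorm_const_smul]
          refine add_le_add hu ?_
          simpa using hδ.le
      _ = ε := ENNReal.add_halves ε

theorem exists_seq_continuous_pos_tendsto {f : ℝ → ℝ} (hf0 : ∀ x, 0 ≤ f x) {p : ℝ≥0∞}
    (hp : 1 ≤ p) (hpt : p ≠ ∞) (hfp : MemLp f p) :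
    ∃ g : ℕ → ℝ → ℝ, (∀ n, Continuous (g n)) ∧ (∀ n x, 0 < g n x) ∧ (∀ n, MemLp (g n) p) ∧
      Tendsto (fun n => eLpNorm (g n - f) p volume) atTop (𝓝 0) ∧
      ∀ᵐ x, Tendsto (fun n => g n x) atTop (𝓝 (f x)) := by
  choose g hgc hg0 hgp hgf using fun n : ℕ => exists_continuous_pos_eLpNorm_sub_le hf0 hp hpt hfp
    (ENNReal.inv_ne_zero.2 (ENNReal.natCast_ne_top n))
  have hlim : Tendsto (fun n => eLpNorm (g n - f) p volume) atTop (𝓝 0) :=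
    tendsto_of_tendsto_of_tendsto_of_le_of_le tendsto_const_nhds
      ENNReal.tendsto_inv_nat_nhds_zero (fun _ => zero_le) hgf
  obtain ⟨k, hk, hae⟩ := (tendstoInMeasure_of_tendsto_eLpNorm (one_pos.trans_le hp).ne'
    (fun n => (hgp n).aestronglyMeasurable) hfp.aestronglyMeasurable hlim).exists_seq_tendsto_ae
  exact ⟨fun n => g (k n), fun n => hgc _, fun n => hg0 _, fun n => hgp _,
    hlim.comp hk.tendsto_atTop, hae⟩

theorem quasiMeasurePreserving_dotProduct {ι : Type*} [Fintype ι] {a : ι → ℝ} (ha : a ≠ 0) :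
    Measure.QuasiMeasurePreserving (fun x : ι → ℝ => ∑ m, a m * x m) := by
  have hsurj : Function.Surjective (dotProductBilin ℝ ℝ a) := by
    refine LinearMap.surjective fun h => ha (dotProduct_self_eq_zero.1 ?_)
    exact LinearMap.congr_fun h a
  obtain ⟨c, -, hc⟩ := (dotProductBilin ℝ ℝ a).exists_map_addHaar_eq_smul_addHaar
    volume volume hsurj
  refine ⟨by fun_prop, ?_⟩
  change Measure.map (dotProductBilin ℝ ℝ a) volume ≪ volume
  rw [hc]
  exact Measure.smul_absolutelyContinuous

theorem lintegral_prod_le_of_gaussian_maximizer {M N : ℕ} {a : Fin N → Fin M → ℝ}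
    (ha : ∀ j, a j ≠ 0) (hspan : Submodule.span ℝ (range a) = ⊤) {p : Fin N → ℝ≥0∞}
    (hp : ∀ j, 1 ≤ p j) {s : Fin N → ℝ} (hs : ∀ j, 0 < s j)
    (hmax : BLratio M N a p (fun j y => Real.exp (-(s j * y) ^ 2 / 2)) = BLGaussConst M N a p)
    {f : Fin N → ℝ → ℝ} (hf0 : ∀ j x, 0 ≤ f j x) (hfp : ∀ j, MemLp (f j) (p j)) :
    ∫⁻ x : Fin M → ℝ, ∏ j, ENNReal.ofReal (f j (∑ m, a j m * x m)) ≤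
      BLGaussConst M N a p * ∏ j, eLpNorm (f j) (p j) volume := by
  have hp0 : ∀ j, p j ≠ 0 := fun j => (one_pos.trans_le (hp j)).ne'
  have hpt := ne_top_of_gaussian_maximizer ha hspan hp hs hmax
  have hC : BLGaussConst M N a p ≠ ∞ := by
    rw [← hmax, BLratio, lintegral_prod_exp_neg_sq hspan hs]
    exact ENNReal.div_ne_top (ENNReal.mul_ne_top ofReal_ne_top (stdGaussianLIntegral_ne_top _))
      (Finset.prod_ne_zero_iff.2 fun j _ => eLpNorm_exp_neg_sq_ne_zero _ (hp0 j))
  choose g hgc hg0 hgp hgf hgae using fun j =>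
    exists_seq_continuous_pos_tendsto (hf0 j) (hp j) (hpt j) (hfp j)
  have hae : ∀ᵐ x : Fin M → ℝ, ∏ j, ENNReal.ofReal (f j (∑ m, a j m * x m)) =
      liminf (fun n => ∏ j, ENNReal.ofReal (g j n (∑ m, a j m * x m))) atTop := by
    filter_upwards [ae_all_iff.2 fun j => (quasiMeasurePreserving_dotProduct (ha j)).ae (hgae j)]
      with x hx
    exact (ENNReal.tendsto_finsetProd_of_ne_top _
      (fun j _ => ENNReal.tendsto_ofReal (hx j)) fun j _ => ofReal_ne_top).liminf_eq.symm
  have hlim : Tendsto (fun n => BLGaussConst M N a p *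
        ∏ j, (eLpNorm (g j n - f j) (p j) volume + eLpNorm (f j) (p j) volume)) atTop
      (𝓝 (BLGaussConst M N a p * ∏ j, eLpNorm (f j) (p j) volume)) := by
    refine ENNReal.Tendsto.const_mul (ENNReal.tendsto_finsetProd_of_ne_top _ (fun j _ => ?_)
      fun j _ => (hfp j).eLpNorm_ne_top) (Or.inr hC)
    simpa only [zero_add] using (hgf j).add_const (eLpNorm (f j) (p j) volume)
  calc ∫⁻ x : Fin M → ℝ, ∏ j, ENNReal.ofReal (f j (∑ m, a j m * x m))
      = ∫⁻ x : Fin M → ℝ, liminf (fun n => ∏ j, ENNReal.ofReal (g j n (∑ m, a j m * x m))) atTop :=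
        lintegral_congr_ae hae
    _ ≤ liminf (fun n => ∫⁻ x : Fin M → ℝ, ∏ j, ENNReal.ofReal (g j n (∑ m, a j m * x m))) atTop :=
        lintegral_liminf_le fun n => Finset.measurable_prod _ fun j _ =>
          ENNReal.measurable_ofReal.comp ((hgc j n).measurable.comp (by fun_prop))
    _ ≤ liminf (fun n => BLGaussConst M N a p *
        ∏ j, (eLpNorm (g j n - f j) (p j) volume + eLpNorm (f j) (p j) volume)) atTop := by
        refine liminf_le_liminf (Eventually.of_forall fun n => ?_)
        refine (lintegral_prod_le_of_continuous hspan hp hs hpt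
          (fun t ht => prod_rpow_mul_det_le_of_gaussian_maximizer hspan hp hs hmax ht)
          (fun j => hgc j n) (fun j => hg0 j n) fun j => hgp j n).trans ?_
        rw [hmax]
        refine mul_le_mul_right (Finset.prod_le_prod' fun j _ => ?_) _
        have := eLpNorm_add_le ((hgp j n).sub (hfp j)).aestronglyMeasurable
          (hfp j).aestronglyMeasurable (hp j)
        rwa [sub_add_cancel] at this
    _ = _ := hlim.liminf_eq

theorem BLratio_eq_zero_of_eLpNorm_eq_zero {M N : ℕ} {a : Fin N → Fin M → ℝ}
    {p : Fin N → ℝ≥0∞} {f : Fin N → ℝ → ℝ} {j : Fin N} (ha : a j ≠ 0) (hp : p j ≠ 0)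
    (hf : AEStronglyMeasurable (f j)) (h : eLpNorm (f j) (p j) volume = 0) :
    BLratio M N a p f = 0 := by
  have hae := (quasiMeasurePreserving_dotProduct ha).ae ((eLpNorm_eq_zero_iff hf hp).1 h)
  have : ∫⁻ x : Fin M → ℝ, ∏ j, ENNReal.ofReal (f j (∑ m, a j m * x m)) = 0 := by
    rw [lintegral_congr_ae (g := 0), lintegral_zero_fun]
    filter_upwards [hae] with x hx
    exact Finset.prod_eq_zero (Finset.mem_univ j) (by simp [hx])
  rw [BLratio, this, ENNReal.zero_div]

end

/-- Brascamp–Lieb via heat flow: if the Gaussian variational problem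
attains its supremum, then `D(p) = D_G(p)`. -/
theorem brascampLieb_of_gaussian_maximizer (M N : ℕ) (hMN : M ≤ N)
    (a : Fin N → Fin M → ℝ) (ha : ∀ j, a j ≠ 0)
    (hspan : Submodule.span ℝ (Set.range a) = ⊤)
    (p : Fin N → ℝ≥0∞) (hp : ∀ j, 1 ≤ p j)
    (hattained : ∃ s : Fin N → ℝ, (∀ j, 0 < s j) ∧
      BLratio M N a p (fun j y => Real.exp (-(s j * y) ^ 2 / 2)) =
        BLGaussConst M N a p) :
    BLconst M N a p = BLGaussConst M N a p := by
  obtain ⟨s, hs, hmax⟩ := hattained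
  refine le_antisymm (iSup₂_le fun f hf => ?_) (iSup_le fun c => iSup₂_le fun s hcs =>
    le_iSup₂_of_le (fun j y => c j * Real.exp (-(s j * y) ^ 2 / 2))
      (fun j => ⟨by fun_prop, fun x => mul_nonneg (hcs j).1.le (Real.exp_pos _).le⟩) le_rfl)
  have hm : ∀ j, AEStronglyMeasurable (f j) := fun j => (hf j).1.aestronglyMeasurable
  by_cases h0 : ∃ j, eLpNorm (f j) (p j) volume = 0
  · obtain ⟨j, hj⟩ := h0
    rw [BLratio_eq_zero_of_eLpNorm_eq_zero (ha j) (one_pos.trans_le (hp j)).ne' (hm j) hj]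
    exact zero_le
  by_cases ht : ∃ j, eLpNorm (f j) (p j) volume = ∞
  · obtain ⟨j, hj⟩ := ht
    have : ∏ j, eLpNorm (f j) (p j) volume = ∞ := by
      rw [← Finset.mul_prod_erase _ _ (Finset.mem_univ j), hj,
        ENNReal.top_mul (Finset.prod_ne_zero_iff.2 fun i _ => not_exists.1 h0 i)]
    rw [BLratio, this, ENNReal.div_top]
    exact zero_le
  · exact ENNReal.div_le_of_le_mul (lintegral_prod_le_of_gaussian_maximizer ha hspan hp hs hmax
      (fun j => (hf j).2) fun j => ⟨hm j, lt_top_iff_ne_top.2 (not_exists.1 ht j)⟩)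
end

section
/- Partial scaling necessary condition: if for some nonempty proper subset S of {1,...,N} one has ∑_{j∈S} 1/p_j > dim span{a_j : j ∈ S}, then D(p) = +∞, i.e., there is no finite constant D with ∫_{ℝ^M} ∏_j f_j(a_j·x) d^M x ≤ D ∏_j ‖f_j‖_{p_j} for all nonnegative f_j. -/
open MeasureTheory ENNReal

/-- A basis of `ℝ^M` adapted to a subspace `V`: the vectors of `V` only have coordinates in a
set of indices of cardinality `dim V`. -/
theorem exists_basis_adapted (M : ℕ) (V : Submodule ℝ (Fin M → ℝ)) :
    ∃ (b : Module.Basis (Fin M) ℝ (Fin M → ℝ)) (I : Finset (Fin M)),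
      I.card = Module.finrank ℝ V ∧ ∀ v ∈ V, ∀ k ∉ I, b.repr v k = 0 := by
  obtain ⟨W, hW⟩ := V.exists_isCompl
  let b₀ := ((Module.finBasis ℝ V).prod (Module.finBasis ℝ W)).map
    (V.prodEquivOfIsCompl W hW)
  let e := b₀.indexEquiv (Pi.basisFun ℝ (Fin M))
  refine ⟨b₀.reindex e, Finset.univ.map (Function.Embedding.inl.trans e.toEmbedding), by simp,
    fun v hv k hk => ?_⟩
  obtain ⟨k, rfl⟩ := e.surjective k
  rcases k with k | k
  · simp at hk
  · have h : (V.prodEquivOfIsCompl W hW).symm v = (⟨v, hv⟩, 0) :=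
      Submodule.prodEquivOfIsCompl_symm_apply_left V W hW ⟨v, hv⟩
    simp [b₀, h]

/-- The volume of a parallelepiped `{x | ∀ k, |b_k · x| ≤ ρ_k}`, up to a constant depending on the
basis `b` only. -/
theorem exists_volume_parallelepiped_eq (M : ℕ) (b : Module.Basis (Fin M) ℝ (Fin M → ℝ)) :
    ∃ K : ℝ, 0 < K ∧ ∀ ρ : Fin M → ℝ, (∀ k, 0 ≤ ρ k) →
      volume {x : Fin M → ℝ | ∀ k, |∑ m, b k m * x m| ≤ ρ k} =
        ENNReal.ofReal (K * ∏ k, ρ k) := by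
  let A : Matrix (Fin M) (Fin M) ℝ := Matrix.of b
  have hA : LinearMap.det (Matrix.toLin' A) ≠ 0 := by
    rw [LinearMap.det_toLin']
    have hu : IsUnit A := Matrix.linearIndependent_rows_iff_isUnit.mp b.linearIndependent
    exact ((Matrix.isUnit_iff_isUnit_det A).mp hu).ne_zero
  refine ⟨|(LinearMap.det (Matrix.toLin' A))⁻¹| * 2 ^ M, by positivity, fun ρ hρ => ?_⟩
  have hset : {x : Fin M → ℝ | ∀ k, |∑ m, b k m * x m| ≤ ρ k} =
      Matrix.toLin' A ⁻¹' Set.Icc (fun k => -ρ k) ρ := by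
    ext x
    simp [A, Matrix.mulVec, dotProduct, abs_le, Pi.le_def, forall_and]
  rw [hset, Measure.addHaar_preimage_linearMap _ hA, Real.volume_Icc_pi,
    ← ENNReal.ofReal_prod_of_nonneg (fun k _ => by linarith [hρ k]),
    ← ENNReal.ofReal_mul (abs_nonneg _), mul_assoc]
  congr 2
  simp_rw [sub_neg_eq_add, ← two_mul]
  rw [Finset.prod_mul_distrib]
  simp

/-- Lower bound for the volume of the set where all the linear forms `a_j` are at most `1 / 2` and
those in `S` are at most `ε / 2`. -/
theorem exists_le_volume_abs_le (M N : ℕ) (a : Fin N → Fin M → ℝ) (S : Finset (Fin N)) :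
    ∃ K : ℝ, 0 < K ∧ ∀ ε : ℝ, 0 < ε → ε ≤ 1 →
      ENNReal.ofReal (K * ε ^ Module.finrank ℝ (Submodule.span ℝ (a '' ↑S))) ≤
        volume {x : Fin M → ℝ | ∀ j, |∑ m, a j m * x m| ≤ (if j ∈ S then ε else 1) / 2} := by
  obtain ⟨b, I, hI, hV⟩ := exists_basis_adapted M (Submodule.span ℝ (a '' ↑S))
  obtain ⟨K, hK, hvol⟩ := exists_volume_parallelepiped_eq M b
  set C : ℝ := 1 + ∑ j, ∑ k, |b.repr (a j) k| with hC
  have hC0 : 0 < C := by positivity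
  have hCj : ∀ j, ∑ k, |b.repr (a j) k| ≤ C := fun j => by
    have := Finset.single_le_sum (f := fun j => ∑ k, |b.repr (a j) k|)
      (fun _ _ => by positivity) (Finset.mem_univ j)
    linarith
  refine ⟨K * (1 / (2 * C)) ^ M, by positivity, fun ε hε hε1 => ?_⟩
  have hprod : ∏ k : Fin M, 1 / (2 * C) * (if k ∈ I then ε else 1) =
      (1 / (2 * C)) ^ M * ε ^ I.card := by
    rw [Finset.prod_mul_distrib, Finset.prod_ite_mem]
    simp
  rw [← hI, mul_assoc, ← hprod, ← hvol _ fun k => by split_ifs <;> positivity]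
  refine measure_mono fun x hx j => ?_
  simp only [Set.mem_ofPred_eq] at hx
  have hexp : ∑ m, a j m * x m = ∑ k, b.repr (a j) k * ∑ m, b k m * x m := by
    conv_lhs => rw [← b.sum_repr (a j)]
    simp only [Finset.sum_apply, Pi.smul_apply, smul_eq_mul, Finset.sum_mul, Finset.mul_sum]
    rw [Finset.sum_comm]
    simp only [mul_assoc]
  rw [hexp]
  have hδ : (0 : ℝ) ≤ if j ∈ S then ε else 1 := by split_ifs <;> positivity
  calc |∑ k, b.repr (a j) k * ∑ m, b k m * x m|
      ≤ ∑ k, |b.repr (a j) k| * |∑ m, b k m * x m| := by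
        simpa only [abs_mul] using Finset.abs_sum_le_sum_abs
          (fun k => b.repr (a j) k * ∑ m, b k m * x m) Finset.univ
    _ ≤ ∑ k, |b.repr (a j) k| * (1 / (2 * C) * (if j ∈ S then ε else 1)) := by
        refine Finset.sum_le_sum fun k _ => ?_
        by_cases hz : b.repr (a j) k = 0
        · simp [hz]
        refine mul_le_mul_of_nonneg_left ((hx k).trans ?_) (abs_nonneg _)
        refine mul_le_mul_of_nonneg_left ?_ (by positivity)
        by_cases hj : j ∈ S
        · have hk : k ∈ I := by
            by_contra hk
            exact hz (hV _ (Submodule.subset_span ⟨j, hj, rfl⟩) k hk)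
          simp [hj, hk]
        · simp only [hj, if_false]
          split_ifs <;> linarith
    _ = (∑ k, |b.repr (a j) k|) * (1 / (2 * C) * (if j ∈ S then ε else 1)) := by
        rw [Finset.sum_mul]
    _ ≤ C * (1 / (2 * C) * (if j ∈ S then ε else 1)) := by
        gcongr
        exact hCj j
    _ = (if j ∈ S then ε else 1) / 2 := by field_simp

/-- The `L^q` norm of the indicator of a centred interval of length `ρ`. -/
theorem eLpNorm_indicator_Icc (ρ : ℝ) (hρ : 0 < ρ) (q : ℝ≥0∞) (hq : q ≠ 0) :
    eLpNorm ((Set.Icc (-(ρ / 2)) (ρ / 2)).indicator fun _ => (1 : ℝ)) q volume =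
      ENNReal.ofReal (ρ ^ (q⁻¹).toReal) := by
  have hv : volume (Set.Icc (-(ρ / 2)) (ρ / 2)) = ENNReal.ofReal ρ := by
    rw [Real.volume_Icc]
    congr 1
    ring
  rw [eLpNorm_indicator_const' measurableSet_Icc (by simp [hv, hρ]) hq, hv,
    ENNReal.ofReal_rpow_of_pos hρ]
  simp [ENNReal.toReal_inv]

/-- Testing the Brascamp–Lieb constant on indicators of intervals. -/
theorem volume_div_le_BLconst (M N : ℕ) (a : Fin N → Fin M → ℝ) (p : Fin N → ℝ≥0∞)
    (hp : ∀ j, p j ≠ 0) (ρ : Fin N → ℝ) (hρ : ∀ j, 0 < ρ j) :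
    volume {x : Fin M → ℝ | ∀ j, |∑ m, a j m * x m| ≤ ρ j / 2} /
      ENNReal.ofReal (∏ j, ρ j ^ ((p j)⁻¹).toReal) ≤ BLconst M N a p := by
  let f : Fin N → ℝ → ℝ := fun j => (Set.Icc (-(ρ j / 2)) (ρ j / 2)).indicator fun _ => 1
  have hf : ∀ j, Measurable (f j) ∧ ∀ x, 0 ≤ f j x := fun j =>
    ⟨measurable_const.indicator measurableSet_Icc,
      fun x => Set.indicator_nonneg (fun _ _ => zero_le_one) x⟩
  refine le_trans ?_ (le_iSup₂ (f := fun f _ => BLratio M N a p f) f hf)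
  rw [BLratio, Finset.prod_congr rfl fun j _ => eLpNorm_indicator_Icc (ρ j) (hρ j) (p j) (hp j),
    ENNReal.ofReal_prod_of_nonneg fun j _ => by have := hρ j; positivity]
  refine ENNReal.div_le_div_right ?_ _
  have hmeas : MeasurableSet {x : Fin M → ℝ | ∀ j, |∑ m, a j m * x m| ≤ ρ j / 2} := by
    simp only [Set.ofPred_forall]
    exact MeasurableSet.iInter fun j => measurableSet_le (by fun_prop) (by fun_prop)
  rw [← lintegral_indicator_one hmeas]
  refine lintegral_mono fun x => ?_
  by_cases hx : x ∈ {x : Fin M → ℝ | ∀ j, |∑ m, a j m * x m| ≤ ρ j / 2}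
  · have h1 : ∀ j, f j (∑ m, a j m * x m) = 1 := fun j =>
      Set.indicator_of_mem (Set.mem_Icc.mpr (abs_le.mp (hx j))) _
    simp [h1, Set.indicator_of_mem hx]
  · simp only [Set.indicator_of_notMem hx, zero_le]

/-- partial scaling necessary condition: if for some nonempty proper
`S ⊆ {1,…,N}` one has `∑_{j∈S} 1/p_j > dim span{a_j : j ∈ S}`, then `D(p) = +∞`. -/
theorem BLconst_eq_top_of_supercritical (M N : ℕ)
    (a : Fin N → Fin M → ℝ)
    (hspan : Submodule.span ℝ (Set.range a) = ⊤)
    (p : Fin N → ℝ≥0∞) (hp : ∀ j, 1 ≤ p j)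
    (S : Finset (Fin N)) (hS1 : S.Nonempty) (hS2 : S ≠ Finset.univ)
    (hsuper : (Module.finrank ℝ (Submodule.span ℝ (a '' ↑S)) : ℝ≥0∞) <
      ∑ j ∈ S, (p j)⁻¹) :
    BLconst M N a p = ⊤ := by
  have hp0 : ∀ j, p j ≠ 0 := fun j => (zero_lt_one.trans_le (hp j)).ne'
  have hpfin : ∀ j, (p j)⁻¹ ≠ ⊤ := fun j => ENNReal.inv_ne_top.mpr (hp0 j)
  obtain ⟨K, hK, hvol⟩ := exists_le_volume_abs_le M N a S
  set r := Module.finrank ℝ (Submodule.span ℝ (a '' ↑S))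
  set σ : ℝ := ∑ j ∈ S, ((p j)⁻¹).toReal with hσ
  have hrσ : (r : ℝ) < σ := by
    have h := ENNReal.toReal_strict_mono (ENNReal.sum_ne_top.mpr fun j _ => hpfin j) hsuper
    rwa [ENNReal.toReal_natCast, ENNReal.toReal_sum fun j _ => hpfin j] at h
  have hbound : ∀ t : ℝ, 1 ≤ t → ENNReal.ofReal (K * t ^ (σ - r)) ≤ BLconst M N a p := by
    intro t ht
    have ht0 : 0 < t := by linarith
    have hρ : ∀ j, 0 < (if j ∈ S then t⁻¹ else 1) := fun j => by split_ifs <;> positivity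
    refine le_trans ?_ (volume_div_le_BLconst M N a p hp0 (fun j => if j ∈ S then t⁻¹ else 1) hρ)
    have hprod : ∏ j, (if j ∈ S then t⁻¹ else 1) ^ ((p j)⁻¹).toReal = t⁻¹ ^ σ := by
      rw [hσ, Real.rpow_sum_of_pos (by positivity), ← Finset.prod_subset (Finset.subset_univ S)
        fun j _ hj => by simp [hj]]
      exact Finset.prod_congr rfl fun j hj => by rw [if_pos hj]
    rw [hprod]
    refine le_trans (le_of_eq ?_)
      (ENNReal.div_le_div_right (hvol t⁻¹ (by positivity) (inv_le_one_of_one_le₀ ht)) _)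
    rw [← ENNReal.ofReal_div_of_pos (by positivity), Real.rpow_sub ht0, Real.inv_rpow ht0.le,
      Real.rpow_natCast, inv_pow]
    congr 1
    field_simp
  have hlim : Filter.Tendsto (fun t : ℝ => ENNReal.ofReal (K * t ^ (σ - r))) Filter.atTop
      (nhds ⊤) :=
    ENNReal.tendsto_ofReal_atTop.comp
      ((tendsto_rpow_atTop (sub_pos.mpr hrσ)).const_mul_atTop hK)
  exact top_le_iff.mp (le_of_tendsto hlim ((Filter.eventually_ge_atTop 1).mono hbound))
end

section
/- Finiteness criterion (Barthe): let a_1,...,a_N span ℝ^M and for p_j ∈ [1,∞] set z_j = 1/p_j. Then D_G(p) < ∞ if and only if z ∈ K_A, where K_A = { z ∈ [0,1]^N : ∑_j z_j = M and ∑_{j∈S} z_j ≤ dim span{a_j : j∈S} for all S ⊆ {1,...,N} }. Moreover if z ∈ K_A° (all inequalities strict for proper nonempty S), the Gaussian supremum is attained. -/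
open MeasureTheory ENNReal

/-- The Gaussian integral `∫ ∏_j e^{-(s_j ⟨a_j, x⟩)² / 2} dx`. -/
noncomputable def gaussInt {M N : ℕ} (a : Fin N → Fin M → ℝ) (s : Fin N → ℝ) : ℝ≥0∞ :=
  ∫⁻ x : Fin M → ℝ, ENNReal.ofReal (Real.exp (-(∑ j, (s j * ∑ m, a j m * x m) ^ 2) / 2))

/-- The scale-normalised Gaussian functional, in logarithmic coordinates `s_j = e^{w_j}`. -/
noncomputable def gaussFun {M N : ℕ} (a : Fin N → Fin M → ℝ) (z w : Fin N → ℝ) : ℝ≥0∞ :=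
  gaussInt a (fun j => Real.exp (w j)) * ENNReal.ofReal (Real.exp (∑ j, z j * w j))

theorem eLpNorm_gaussian_top {c : ℝ} (hc : 0 < c) (s : ℝ) :
    eLpNorm (fun y : ℝ => c * Real.exp (-(s * y) ^ 2 / 2)) ⊤ volume = ENNReal.ofReal c := by
  rw [eLpNorm_exponent_top]
  have hcont : Continuous fun y : ℝ => c * Real.exp (-(s * y) ^ 2 / 2) := by fun_prop
  have hen : ∀ y : ℝ, ‖c * Real.exp (-(s * y) ^ 2 / 2)‖ₑ
      = ENNReal.ofReal (c * Real.exp (-(s * y) ^ 2 / 2)) := fun y =>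
    Real.enorm_of_nonneg (by positivity)
  refine le_antisymm ?_ ?_
  · refine essSup_le_of_ae_le _ (Filter.Eventually.of_forall fun y => ?_)
    simp only [hen]
    refine ENNReal.ofReal_le_ofReal ?_
    have : Real.exp (-(s * y) ^ 2 / 2) ≤ 1 := by
      rw [Real.exp_le_one_iff]
      nlinarith [sq_nonneg (s * y)]
    nlinarith
  · have hae := enorm_ae_le_eLpNormEssSup (fun y : ℝ => c * Real.exp (-(s * y) ^ 2 / 2)) volume
    have hd := Measure.dense_of_ae hae
    have hcl : IsClosed {y : ℝ | ‖c * Real.exp (-(s * y) ^ 2 / 2)‖ₑ ≤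
        eLpNormEssSup (fun y : ℝ => c * Real.exp (-(s * y) ^ 2 / 2)) volume} :=
      isClosed_le hcont.enorm continuous_const
    have h0 : (0 : ℝ) ∈ {y : ℝ | ‖c * Real.exp (-(s * y) ^ 2 / 2)‖ₑ ≤
        eLpNormEssSup (fun y : ℝ => c * Real.exp (-(s * y) ^ 2 / 2)) volume} := by
      rw [← hcl.closure_eq]
      exact hd 0
    simpa [hen] using h0

theorem lintegral_gaussian_mul {b : ℝ} (hb : 0 < b) {s : ℝ} (hs : 0 < s) :
    ∫⁻ y : ℝ, ENNReal.ofReal (Real.exp (-b * (s * y) ^ 2)) =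
      ENNReal.ofReal (√(Real.pi / b) * s⁻¹) := by
  have heq : ∀ y : ℝ, -b * (s * y) ^ 2 = -(b * s ^ 2) * y ^ 2 := fun y => by ring
  simp_rw [heq]
  rw [← ofReal_integral_eq_lintegral_ofReal (integrable_exp_neg_mul_sq (by positivity))
    (Filter.Eventually.of_forall fun y => (Real.exp_pos _).le), integral_gaussian]
  congr 1
  rw [← div_div, Real.sqrt_div (by positivity), Real.sqrt_sq hs.le, div_eq_mul_inv]

theorem exists_eLpNorm_gaussian {p : ℝ≥0∞} (hp : 1 ≤ p) :
    ∃ κ : ℝ, 0 < κ ∧ ∀ c s : ℝ, 0 < c → 0 < s →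
      eLpNorm (fun y : ℝ => c * Real.exp (-(s * y) ^ 2 / 2)) p volume =
        ENNReal.ofReal (c * κ * (s ^ (p⁻¹).toReal)⁻¹) := by
  by_cases hpt : p = ⊤
  · subst hpt
    exact ⟨1, one_pos, fun c s hc _ => by rw [eLpNorm_gaussian_top hc]; simp⟩
  have hp0 : p ≠ 0 := (one_pos.trans_le hp).ne'
  have hq : 0 < p.toReal := ENNReal.toReal_pos hp0 hpt
  refine ⟨(√(Real.pi / (p.toReal / 2))) ^ (p⁻¹).toReal, by positivity, fun c s hc hs => ?_⟩
  rw [eLpNorm_eq_lintegral_rpow_enorm_toReal hp0 hpt]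
  have hfun : ∀ y : ℝ, ‖c * Real.exp (-(s * y) ^ 2 / 2)‖ₑ ^ p.toReal
      = ENNReal.ofReal (c ^ p.toReal) *
        ENNReal.ofReal (Real.exp (-(p.toReal / 2) * (s * y) ^ 2)) := by
    intro y
    rw [Real.enorm_of_nonneg (by positivity), ENNReal.ofReal_rpow_of_pos (by positivity),
      ← ENNReal.ofReal_mul (by positivity), Real.mul_rpow hc.le (Real.exp_pos _).le,
      ← Real.exp_mul]
    congr 3
    ring
  simp_rw [hfun]
  rw [lintegral_const_mul _ (by fun_prop), lintegral_gaussian_mul (by positivity) hs,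
    ← ENNReal.ofReal_mul (by positivity), ENNReal.ofReal_rpow_of_pos (by positivity)]
  congr 1
  rw [ENNReal.toReal_inv, one_div, Real.mul_rpow (by positivity) (by positivity),
    Real.mul_rpow (by positivity) (by positivity), Real.rpow_rpow_inv hc.le hq.ne',
    Real.inv_rpow hs.le]
  ring

theorem exists_BLratio_gaussian {M N : ℕ} (a : Fin N → Fin M → ℝ) (p : Fin N → ℝ≥0∞)
    (hp : ∀ j, 1 ≤ p j) :
    ∃ K : ℝ, 0 < K ∧ ∀ c w : Fin N → ℝ, (∀ j, 0 < c j) →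
      BLratio M N a p (fun j y => c j * Real.exp (-(Real.exp (w j) * y) ^ 2 / 2)) =
        ENNReal.ofReal K * gaussFun a (fun j => ((p j)⁻¹).toReal) w := by
  choose κ hκ hnorm using fun j => exists_eLpNorm_gaussian (hp j)
  refine ⟨(∏ j, κ j)⁻¹, inv_pos.2 (Finset.prod_pos fun j _ => hκ j), fun c w hc => ?_⟩
  have hcp : 0 < ∏ j, c j := Finset.prod_pos fun j _ => hc j
  have hκp : 0 < ∏ j, κ j := Finset.prod_pos fun j _ => hκ j
  have hden : ∏ j, eLpNorm (fun y => c j * Real.exp (-(Real.exp (w j) * y) ^ 2 / 2)) (p j) volume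
      = ENNReal.ofReal ((∏ j, c j) * (∏ j, κ j) *
        (Real.exp (∑ j, ((p j)⁻¹).toReal * w j))⁻¹) := by
    simp_rw [fun j => hnorm j (c j) (Real.exp (w j)) (hc j) (Real.exp_pos _)]
    rw [← ENNReal.ofReal_prod_of_nonneg
      (fun j _ => by have := hc j; have := hκ j; positivity)]
    rw [Finset.prod_mul_distrib, Finset.prod_mul_distrib, Finset.prod_inv_distrib, Real.exp_sum]
    congr 4
    ext j
    rw [← Real.exp_mul, mul_comm]
  have hnum : ∀ x : Fin M → ℝ,
      ∏ j, ENNReal.ofReal (c j * Real.exp (-(Real.exp (w j) * ∑ m, a j m * x m) ^ 2 / 2))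
        = ENNReal.ofReal (∏ j, c j) * ENNReal.ofReal
          (Real.exp (-(∑ j, (Real.exp (w j) * ∑ m, a j m * x m) ^ 2) / 2)) := by
    intro x
    rw [← ENNReal.ofReal_mul hcp.le, ← ENNReal.ofReal_prod_of_nonneg
      (fun j _ => by have := hc j; positivity), Finset.prod_mul_distrib, ← Real.exp_sum,
      ← Finset.sum_neg_distrib, Finset.sum_div]
  unfold BLratio gaussFun gaussInt
  rw [hden]
  simp_rw [hnum]
  rw [lintegral_const_mul _ (by fun_prop), div_eq_mul_inv,
    ← ENNReal.ofReal_inv_of_pos (by positivity)]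
  have hreal : ENNReal.ofReal (∏ j, c j) * ENNReal.ofReal ((∏ j, c j) * (∏ j, κ j) *
        (Real.exp (∑ j, ((p j)⁻¹).toReal * w j))⁻¹)⁻¹
      = ENNReal.ofReal (∏ j, κ j)⁻¹ *
        ENNReal.ofReal (Real.exp (∑ j, ((p j)⁻¹).toReal * w j)) := by
    rw [← ENNReal.ofReal_mul (by positivity), ← ENNReal.ofReal_mul (by positivity)]
    congr 1
    field_simp
  rw [mul_right_comm, hreal]
  ring

/-- The Brascamp–Lieb Gaussian constant is a multiple of the supremum of `gaussFun`. -/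
theorem exists_BLGaussConst_eq {M N : ℕ} (a : Fin N → Fin M → ℝ) (p : Fin N → ℝ≥0∞)
    (hp : ∀ j, 1 ≤ p j) :
    ∃ K : ℝ, 0 < K ∧
      (∀ w : Fin N → ℝ,
        BLratio M N a p (fun j y => 1 * Real.exp (-(Real.exp (w j) * y) ^ 2 / 2)) =
          ENNReal.ofReal K * gaussFun a (fun j => ((p j)⁻¹).toReal) w) ∧
      BLGaussConst M N a p =
        ENNReal.ofReal K * ⨆ w, gaussFun a (fun j => ((p j)⁻¹).toReal) w := by
  obtain ⟨K, hK, h⟩ := exists_BLratio_gaussian a p hp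
  refine ⟨K, hK, fun w => h (fun _ => 1) w fun _ => one_pos, le_antisymm ?_ ?_⟩
  · refine iSup_le fun c => iSup_le fun s => iSup_le fun hcs => ?_
    have hs : s = fun j => Real.exp (Real.log (s j)) :=
      funext fun j => (Real.exp_log (hcs j).2).symm
    have := h c (fun j => Real.log (s j)) fun j => (hcs j).1
    rw [hs]
    rw [this]
    gcongr
    exact le_iSup (gaussFun a fun j => ((p j)⁻¹).toReal) _
  · rw [ENNReal.mul_iSup]
    refine iSup_le fun w => ?_
    rw [← h (fun _ => 1) w fun _ => one_pos]
    exact le_iSup_of_le _ (le_iSup_of_le _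
      (le_iSup_of_le (fun j => ⟨one_pos, Real.exp_pos _⟩) le_rfl))

theorem exists_lintegral_gaussian_matrix {M : ℕ} {B : Matrix (Fin M) (Fin M) ℝ}
    (hB : B.det ≠ 0) :
    ∃ C : ℝ, 0 < C ∧ ∀ s : Fin M → ℝ, (∀ i, 0 < s i) →
      ∫⁻ x : Fin M → ℝ,
        ENNReal.ofReal (Real.exp (-(∑ i, (s i * ∑ m, B i m * x m) ^ 2) / 2)) =
      ENNReal.ofReal (C * ∏ i, (s i)⁻¹) := by
  refine ⟨|B.det⁻¹| * ∏ _i : Fin M, √(Real.pi / (1 / 2)), by positivity, fun s hs => ?_⟩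
  let F : (Fin M → ℝ) → ℝ≥0∞ :=
    fun y => ENNReal.ofReal (Real.exp (-(∑ i, (s i * y i) ^ 2) / 2))
  have hF : Measurable F := by fun_prop
  have hcomp : ∀ x : Fin M → ℝ,
      ENNReal.ofReal (Real.exp (-(∑ i, (s i * ∑ m, B i m * x m) ^ 2) / 2))
        = F (Matrix.toLin' B x) := fun x => rfl
  have hone : ∀ i, ∫ y : ℝ, Real.exp (-(1 / 2 : ℝ) * (s i * y) ^ 2)
      = √(Real.pi / (1 / 2)) * (s i)⁻¹ := by
    intro i
    have heq : ∀ y : ℝ, -(1 / 2 : ℝ) * (s i * y) ^ 2 = -(1 / 2 * s i ^ 2) * y ^ 2 :=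
      fun y => by ring
    simp_rw [heq]
    rw [integral_gaussian, ← div_div, Real.sqrt_div (by positivity),
      Real.sqrt_sq (hs i).le, div_eq_mul_inv]
  have hint : ∀ i, Integrable fun y : ℝ => Real.exp (-(1 / 2 : ℝ) * (s i * y) ^ 2) := by
    intro i
    have heq : ∀ y : ℝ, -(1 / 2 : ℝ) * (s i * y) ^ 2 = -(1 / 2 * s i ^ 2) * y ^ 2 :=
      fun y => by ring
    simp_rw [heq]
    exact integrable_exp_neg_mul_sq (by have := hs i; positivity)
  have hprod : ∀ y : Fin M → ℝ, Real.exp (-(∑ i, (s i * y i) ^ 2) / 2)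
      = ∏ i, Real.exp (-(1 / 2 : ℝ) * (s i * y i) ^ 2) := by
    intro y
    rw [← Real.exp_sum, ← Finset.mul_sum]
    congr 1
    ring
  have hFint : ∫⁻ y, F y = ENNReal.ofReal ((∏ _i : Fin M, √(Real.pi / (1 / 2))) *
      ∏ i, (s i)⁻¹) := by
    simp only [F, hprod]
    have hprodint : Integrable
        (fun y : Fin M → ℝ => ∏ i, Real.exp (-(1 / 2 : ℝ) * (s i * y i) ^ 2)) volume :=
      Integrable.fintype_prod (μ := fun _ => volume)
        (f := fun i y => Real.exp (-(1 / 2 : ℝ) * (s i * y) ^ 2)) hint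
    rw [← ofReal_integral_eq_lintegral_ofReal hprodint
        (Filter.Eventually.of_forall fun y => Finset.prod_nonneg fun i _ => (Real.exp_pos _).le),
      integral_fintype_prod_volume_eq_prod
        (fun i y => Real.exp (-(1 / 2 : ℝ) * (s i * y) ^ 2))]
    simp_rw [hone]
    rw [Finset.prod_mul_distrib]
  simp_rw [hcomp]
  rw [← lintegral_map hF (Matrix.toLin' B).continuous_of_finiteDimensional.measurable,
    Real.map_matrix_volume_pi_eq_smul_volume_pi hB, lintegral_smul_measure, hFint,
    smul_eq_mul, ← ENNReal.ofReal_mul (by positivity), mul_assoc]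

theorem gaussInt_smul {M N : ℕ} (a : Fin N → Fin M → ℝ) (s : Fin N → ℝ) {r : ℝ} (hr : 0 < r) :
    gaussInt a (fun j => r * s j) = ENNReal.ofReal ((r ^ M)⁻¹) * gaussInt a s := by
  let F : (Fin M → ℝ) → ℝ≥0∞ :=
    fun x => ENNReal.ofReal (Real.exp (-(∑ j, (s j * ∑ m, a j m * x m) ^ 2) / 2))
  have hF : Measurable F := by fun_prop
  have hcomp : ∀ x : Fin M → ℝ,
      ENNReal.ofReal (Real.exp (-(∑ j, (r * s j * ∑ m, a j m * x m) ^ 2) / 2)) = F (r • x) := by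
    intro x
    simp only [F, Pi.smul_apply, smul_eq_mul]
    congr 6
    ext j
    rw [mul_comm r, mul_assoc, Finset.mul_sum]
    congr 3
    ext m
    ring
  unfold gaussInt
  simp_rw [hcomp]
  rw [← lintegral_map hF (measurable_const_smul r), Measure.map_addHaar_smul _ hr.ne',
    lintegral_smul_measure, smul_eq_mul, abs_of_pos (by positivity)]
  simp [F]

theorem exists_greedy_basis {M N : ℕ} (a : Fin N → Fin M → ℝ)
    (hspan : Submodule.span ℝ (Set.range a) = ⊤) (σ : Equiv.Perm (Fin N)) :
    ∃ e : Fin M → Fin N, LinearIndependent ℝ (a ∘ e) ∧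
      ∀ k, a (σ k) ∈ Submodule.span ℝ ((a ∘ e) '' {i | σ.symm (e i) ≤ k}) := by
  classical
  let b : Fin N → Fin M → ℝ := a ∘ σ
  let I : Set (Fin N) := {k | b k ∉ Submodule.span ℝ (b '' Set.Iio k)}
  have hmem : ∀ k, b k ∈ Submodule.span ℝ (b '' (I ∩ Set.Iic k)) := by
    intro k
    induction k using WellFoundedLT.induction with
    | _ k ih =>
      by_cases hk : k ∈ I
      · exact Submodule.subset_span ⟨k, ⟨hk, Set.self_mem_Iic⟩, rfl⟩
      · have hk' : b k ∈ Submodule.span ℝ (b '' Set.Iio k) := not_not.1 hk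
        refine Submodule.span_le.2 ?_ hk'
        rintro _ ⟨l, hl, rfl⟩
        exact Submodule.span_mono
          (Set.image_mono (Set.inter_subset_inter_right _ (Set.Iic_subset_Iic.2 hl.le))) (ih l hl)
  have hli : LinearIndependent ℝ (fun i : I => b i) := by
    rw [linearIndependent_iff']
    intro s g hg
    by_contra! hne
    obtain ⟨i₀, hi₀, hgi₀⟩ := hne
    obtain ⟨m, hm, hmax⟩ := (s.filter fun i => g i ≠ 0).exists_max_image id
      ⟨i₀, Finset.mem_filter.2 ⟨hi₀, hgi₀⟩⟩
    obtain ⟨hms, hgm⟩ := Finset.mem_filter.1 hm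
    refine m.2 ?_
    rw [← Finset.add_sum_erase s _ hms] at hg
    have hbm : b m = (g m)⁻¹ • -∑ i ∈ s.erase m, g i • b i := by
      rw [← eq_neg_of_add_eq_zero_left hg, smul_smul, inv_mul_cancel₀ hgm, one_smul]
    rw [hbm]
    refine Submodule.smul_mem _ _ (Submodule.neg_mem _ (Submodule.sum_mem _ fun i hi => ?_))
    obtain ⟨him, his⟩ := Finset.mem_erase.1 hi
    by_cases hgi : g i = 0
    · simp [hgi]
    · exact Submodule.smul_mem _ _ (Submodule.subset_span ⟨i, lt_of_le_of_ne
        (hmax i (Finset.mem_filter.2 ⟨his, hgi⟩)) him, rfl⟩)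
  have htop : Submodule.span ℝ (Set.range fun i : I => b i) = ⊤ := by
    rw [eq_top_iff, ← hspan, Submodule.span_le]
    rintro _ ⟨j, rfl⟩
    have hj := hmem (σ.symm j)
    simp only [b, Function.comp_apply, Equiv.apply_symm_apply] at hj
    refine Submodule.span_mono ?_ hj
    rintro _ ⟨i, hi, rfl⟩
    exact ⟨⟨i, hi.1⟩, rfl⟩
  have hcard : Fintype.card I = M := by
    rw [← finrank_span_eq_card hli, htop, finrank_top, Module.finrank_fin_fun]
  let ε : Fin M ≃ I := (Fintype.equivFinOfCardEq hcard).symm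
  refine ⟨fun i => σ (ε i), hli.comp ε ε.injective, fun k => Submodule.span_mono ?_ (hmem k)⟩
  rintro _ ⟨i, ⟨hiI, hik⟩, rfl⟩
  exact ⟨ε.symm ⟨i, hiI⟩, by simpa using hik, by simp [b]⟩

/-- Greedy basis for a real weight: every `a j` is spanned by basis vectors of weight at least
that of `j`. -/
theorem exists_basis_of_weight {M N : ℕ} (a : Fin N → Fin M → ℝ)
    (hspan : Submodule.span ℝ (Set.range a) = ⊤) (w : Fin N → ℝ) :
    ∃ e : Fin M → Fin N, LinearIndependent ℝ (a ∘ e) ∧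
      ∀ j, a j ∈ Submodule.span ℝ ((a ∘ e) '' {i | w j ≤ w (e i)}) := by
  obtain ⟨e, he, hmem⟩ := exists_greedy_basis a hspan (Tuple.sort fun j => -w j)
  refine ⟨e, he, fun j => ?_⟩
  have hj := hmem ((Tuple.sort fun j => -w j).symm j)
  rw [Equiv.apply_symm_apply] at hj
  refine Submodule.span_mono (Set.image_mono fun i hi => ?_) hj
  have := Tuple.monotone_sort (fun j => -w j) hi
  simpa using this

theorem le_sum_mul_of_antitone {n : ℕ} (g w : Fin (n + 1) → ℝ) (δ : ℝ) (hw : Antitone w)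
    (hg : ∀ k, k ≠ 0 → δ ≤ ∑ i ∈ Finset.Iio k, g i) :
    (∑ i, g i) * w (Fin.last n) + δ * (w 0 - w (Fin.last n)) ≤ ∑ i, g i * w i := by
  induction n with
  | zero => simp
  | succ n ih =>
    have hlast : δ ≤ ∑ i : Fin (n + 1), g i.castSucc := by
      have := hg (Fin.last (n + 1)) (Fin.last_pos).ne'
      rwa [Fin.Iio_last_eq_map, Finset.sum_map] at this
    have hih := ih (fun i => g i.castSucc) (fun i => w i.castSucc)
      (fun i j hij => hw (Fin.castSucc_le_castSucc_iff.2 hij)) (fun k hk => by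
        have := hg k.castSucc (by rwa [Ne, Fin.castSucc_eq_zero_iff])
        rwa [← Fin.map_castSuccEmb_Iio, Finset.sum_map] at this)
    rw [Fin.sum_univ_castSucc, Fin.sum_univ_castSucc (f := fun i => g i * w i)]
    have hstep : w (Fin.last (n + 1)) ≤ w (Fin.last n).castSucc := hw (Fin.le_last _)
    simp only [Fin.castSucc_zero] at hih
    nlinarith [mul_nonneg (sub_nonneg.2 hlast) (sub_nonneg.2 hstep)]

theorem exists_basis_sum_le {M N : ℕ} (a : Fin N → Fin M → ℝ)
    (hspan : Submodule.span ℝ (Set.range a) = ⊤) (z w : Fin N → ℝ) {δ : ℝ} (hδ : 0 ≤ δ)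
    (hsum : ∑ j, z j = M)
    (hz : ∀ S : Finset (Fin N), S.Nonempty → S ≠ Finset.univ →
      ∑ j ∈ S, z j + δ ≤ Module.finrank ℝ (Submodule.span ℝ (a '' ↑S))) :
    ∃ e : Fin M → Fin N, LinearIndependent ℝ (a ∘ e) ∧ ∑ j, z j * w j ≤ ∑ i, w (e i) ∧
      ∀ j k, ∑ j, z j * w j + δ * (w j - w k) ≤ ∑ i, w (e i) := by
  classical
  obtain _ | n := N
  · have hM : M = 0 := by simpa using hsum.symm
    subst hM
    exact ⟨Fin.elim0, linearIndependent_empty_type, by simp, fun j => j.elim0⟩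
  let σ := Tuple.sort fun j => -w j
  have hanti : Antitone (w ∘ σ) := fun i j hij => by
    simpa using Tuple.monotone_sort (fun j => -w j) hij
  obtain ⟨e, he, hmem⟩ := exists_greedy_basis a hspan σ
  let g : Fin (n + 1) → ℝ := fun k => (∑ i, if σ.symm (e i) = k then 1 else 0) - z (σ k)
  have hcount : ∀ (K : Finset (Fin (n + 1))) (v : Fin (n + 1) → ℝ),
      ∑ k ∈ K, (∑ i, if σ.symm (e i) = k then (1 : ℝ) else 0) * v k
        = ∑ i, if σ.symm (e i) ∈ K then v (σ.symm (e i)) else 0 := by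
    intro K v
    simp_rw [Finset.sum_mul]
    rw [Finset.sum_comm]
    simp [ite_mul]
  have hG : ∀ k, k ≠ 0 → δ ≤ ∑ i ∈ Finset.Iio k, g i := by
    intro k hk
    have hS := hz ((Finset.Iio k).map σ.toEmbedding)
      (Finset.map_nonempty.2 ⟨0, Finset.mem_Iio.2 (Fin.pos_iff_ne_zero.2 hk)⟩)
      (fun h => by
        have : σ k ∈ (Finset.Iio k).map σ.toEmbedding := h ▸ Finset.mem_univ _
        simp at this)
    rw [Finset.sum_map] at hS
    have hle : Submodule.span ℝ (a '' ↑((Finset.Iio k).map σ.toEmbedding)) ≤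
        Submodule.span ℝ ((a ∘ e) '' ↑(Finset.univ.filter fun i => σ.symm (e i) ∈ Finset.Iio k)) := by
      rw [Submodule.span_le]
      rintro _ ⟨_, hj, rfl⟩
      obtain ⟨l, hl, rfl⟩ := Finset.mem_map.1 (Finset.mem_coe.1 hj)
      refine Submodule.span_mono (Set.image_mono fun i hi => ?_) (hmem l)
      simpa using lt_of_le_of_lt hi (Finset.mem_Iio.1 hl)
    have hrank : Module.finrank ℝ (Submodule.span ℝ (a '' ↑((Finset.Iio k).map σ.toEmbedding))) ≤
        (Finset.univ.filter fun i => σ.symm (e i) ∈ Finset.Iio k).card := by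
      refine (Submodule.finrank_mono hle).trans ?_
      rw [← Finset.coe_image]
      exact (finrank_span_finset_le_card _).trans Finset.card_image_le
    have hrank' : (Module.finrank ℝ
        (Submodule.span ℝ (a '' ↑((Finset.Iio k).map σ.toEmbedding))) : ℝ) ≤
        (Finset.univ.filter fun i => σ.symm (e i) ∈ Finset.Iio k).card := by exact_mod_cast hrank
    have hc := hcount (Finset.Iio k) fun _ => 1
    rw [Finset.sum_boole] at hc
    simp only [mul_one] at hc
    simp only [g, Finset.sum_sub_distrib, hc]
    simp only [Equiv.coe_toEmbedding] at hS
    linarith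
  have hσ : ∀ v : Fin (n + 1) → ℝ, ∑ k, v (σ k) = ∑ j, v j := fun v => Equiv.sum_comp σ v
  have hgsum : ∑ k, g k = 0 := by
    have hc := hcount Finset.univ fun _ => 1
    simp only [mul_one, Finset.mem_univ, if_true, Finset.sum_const, Finset.card_univ,
      Fintype.card_fin, nsmul_eq_mul] at hc
    simp only [g, Finset.sum_sub_distrib, hc, hσ z, hsum, sub_self]
  have hgw : ∑ k, g k * (w ∘ σ) k = ∑ i, w (e i) - ∑ j, z j * w j := by
    have hc := hcount Finset.univ (w ∘ σ)
    simp only [Finset.mem_univ, if_true, Function.comp_apply, Equiv.apply_symm_apply] at hc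
    simp only [g, sub_mul, Finset.sum_sub_distrib, Function.comp_apply, hc,
      hσ fun j => z j * w j]
  have hmain := le_sum_mul_of_antitone g (w ∘ σ) δ hanti hG
  rw [hgsum, hgw, zero_mul, zero_add] at hmain
  have hosc : ∀ j k, ∑ j, z j * w j + δ * (w j - w k) ≤ ∑ i, w (e i) := by
    intro j k
    have hj := hanti (Fin.zero_le (σ.symm j))
    have hk := hanti (Fin.le_last (σ.symm k))
    simp only [Function.comp_apply, Equiv.apply_symm_apply] at hj hk hmain
    have := mul_le_mul_of_nonneg_left (sub_le_sub hj hk) hδ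
    linarith
  exact ⟨e, he, by simpa using hosc 0 0, hosc⟩

theorem det_ne_zero_of_linearIndependent {M : ℕ} {b : Fin M → Fin M → ℝ}
    (hb : LinearIndependent ℝ b) : (Matrix.of b).det ≠ 0 :=
  ((Matrix.isUnit_iff_isUnit_det _).1
    ((Matrix.linearIndependent_rows_iff_isUnit (A := Matrix.of b)).1 hb)).ne_zero

theorem exists_gaussFun_le {M N : ℕ} (a : Fin N → Fin M → ℝ) :
    ∃ C : ℝ, 0 ≤ C ∧ ∀ (z w : Fin N → ℝ) (e : Fin M → Fin N), LinearIndependent ℝ (a ∘ e) →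
      gaussFun a z w ≤ ENNReal.ofReal (C * Real.exp (∑ j, z j * w j - ∑ i, w (e i))) := by
  classical
  have hex : ∀ e : Fin M → Fin N, ∃ C : ℝ, 0 ≤ C ∧ (LinearIndependent ℝ (a ∘ e) →
      ∀ w : Fin N → ℝ, gaussInt a (fun j => Real.exp (w j)) ≤
        ENNReal.ofReal (C * Real.exp (-∑ i, w (e i)))) := by
    intro e
    by_cases he : LinearIndependent ℝ (a ∘ e)
    swap
    · exact ⟨0, le_rfl, fun h => absurd h he⟩
    obtain ⟨C, hC, h⟩ := exists_lintegral_gaussian_matrix (det_ne_zero_of_linearIndependent he)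
    refine ⟨C, hC.le, fun _ w => ?_⟩
    have hinj : Function.Injective e := he.injective.of_comp
    have hw := h (fun i => Real.exp (w (e i))) fun i => Real.exp_pos _
    rw [← Finset.sum_neg_distrib, Real.exp_sum]
    simp_rw [Real.exp_neg]
    rw [← hw]
    refine lintegral_mono fun x => ENNReal.ofReal_le_ofReal (Real.exp_le_exp.2 ?_)
    have hle : ∑ i, (Real.exp (w (e i)) * ∑ m, a (e i) m * x m) ^ 2 ≤
        ∑ j, (Real.exp (w j) * ∑ m, a j m * x m) ^ 2 := by
      rw [← Finset.sum_image (s := Finset.univ) (g := e)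
        (f := fun j => (Real.exp (w j) * ∑ m, a j m * x m) ^ 2) hinj.injOn]
      exact Finset.sum_le_sum_of_subset_of_nonneg (Finset.subset_univ _)
        fun j _ _ => sq_nonneg _
    simp only [Matrix.of_apply, Function.comp_apply]
    linarith
  choose C hC h using hex
  refine ⟨∑ e, C e, Finset.sum_nonneg fun e _ => hC e, fun z w e he => ?_⟩
  have hCe : C e ≤ ∑ e, C e := Finset.single_le_sum (fun e _ => hC e) (Finset.mem_univ e)
  calc gaussFun a z w
      ≤ ENNReal.ofReal (C e * Real.exp (-∑ i, w (e i))) *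
          ENNReal.ofReal (Real.exp (∑ j, z j * w j)) := mul_le_mul_left (h e he w) _
    _ = ENNReal.ofReal (C e * Real.exp (∑ j, z j * w j - ∑ i, w (e i))) := by
        rw [← ENNReal.ofReal_mul (mul_nonneg (hC e) (Real.exp_pos _).le), mul_assoc,
          ← Real.exp_add, neg_add_eq_sub]
    _ ≤ _ := ENNReal.ofReal_le_ofReal (mul_le_mul_of_nonneg_right hCe (Real.exp_pos _).le)

theorem exists_le_gaussFun {M N : ℕ} (a : Fin N → Fin M → ℝ) (w : Fin N → ℝ)
    (e : Fin M → Fin N) (he : LinearIndependent ℝ (a ∘ e))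
    (hmem : ∀ j, a j ∈ Submodule.span ℝ ((a ∘ e) '' {i | w j ≤ w (e i)})) :
    ∃ c : ℝ, 0 < c ∧ ∀ (z : Fin N → ℝ) (t : ℝ), 0 ≤ t →
      ENNReal.ofReal (c * Real.exp (t * (∑ j, z j * w j - ∑ i, w (e i)))) ≤
        gaussFun a z (fun j => t * w j) := by
  classical
  have hcoef : ∀ j, ∃ d : Fin M → ℝ, (∀ i, d i ≠ 0 → w j ≤ w (e i)) ∧
      a j = ∑ i, d i • a (e i) := by
    intro j
    have hj := hmem j
    rw [show {i | w j ≤ w (e i)} = ↑(Finset.univ.filter fun i => w j ≤ w (e i)) by ext; simp,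
      Submodule.mem_span_image_finset_iff_exists_fun'] at hj
    obtain ⟨d, hd⟩ := hj
    refine ⟨fun i => if w j ≤ w (e i) then d i else 0, fun i hi => ?_, ?_⟩
    · by_contra hn
      simp [hn] at hi
    · rw [← hd, Finset.sum_filter]
      simp [ite_smul]
  choose d hd hsum using hcoef
  obtain ⟨C, hC, h⟩ := exists_lintegral_gaussian_matrix (det_ne_zero_of_linearIndependent he)
  let D : ℝ := 1 + ∑ j, ∑ i, d j i ^ 2
  have hD : 0 < D := by positivity
  refine ⟨C * (√D ^ M)⁻¹, by positivity, fun z t ht => ?_⟩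
  have hint : ENNReal.ofReal (C * (√D ^ M)⁻¹ * Real.exp (-(t * ∑ i, w (e i)))) ≤
      gaussInt a (fun j => Real.exp (t * w j)) := by
    have hw := h (fun i => √D * Real.exp (t * w (e i))) fun i => by positivity
    have hC' : C * (√D ^ M)⁻¹ * Real.exp (-(t * ∑ i, w (e i)))
        = C * ∏ i, (√D * Real.exp (t * w (e i)))⁻¹ := by
      rw [Finset.prod_inv_distrib, Finset.prod_mul_distrib, ← Real.exp_sum, ← Finset.mul_sum,
        Real.exp_neg, Finset.prod_const, Finset.card_univ, Fintype.card_fin, mul_inv, mul_assoc]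
    rw [hC', ← hw]
    refine lintegral_mono fun x => ENNReal.ofReal_le_ofReal (Real.exp_le_exp.2 ?_)
    have hj : ∀ j, (Real.exp (t * w j) * ∑ m, a j m * x m) ^ 2 ≤
        (∑ i, d j i ^ 2) * ∑ i, (Real.exp (t * w (e i)) * ∑ m, a (e i) m * x m) ^ 2 := by
      intro j
      have hlin : ∑ m, a j m * x m = ∑ i, d j i * ∑ m, a (e i) m * x m := by
        simp_rw [Finset.mul_sum]
        rw [Finset.sum_comm]
        refine Finset.sum_congr rfl fun m _ => ?_
        conv_lhs => rw [hsum j]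
        simp [Finset.sum_apply, Finset.sum_mul, mul_assoc]
      have hrew : Real.exp (t * w j) * ∑ m, a j m * x m =
          ∑ i, (d j i * Real.exp (t * w j - t * w (e i))) *
            (Real.exp (t * w (e i)) * ∑ m, a (e i) m * x m) := by
        rw [hlin, Finset.mul_sum]
        refine Finset.sum_congr rfl fun i _ => ?_
        rw [Real.exp_sub]
        field_simp
      rw [hrew]
      refine (Finset.sum_mul_sq_le_sq_mul_sq _ _ _).trans
        (mul_le_mul_of_nonneg_right (Finset.sum_le_sum fun i _ => ?_)
          (Finset.sum_nonneg fun i _ => sq_nonneg _))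
      by_cases h0 : d j i = 0
      · simp [h0]
      · rw [mul_pow]
        have h1 : Real.exp (t * w j - t * w (e i)) ≤ 1 := by
          rw [Real.exp_le_one_iff, sub_nonpos]
          exact mul_le_mul_of_nonneg_left (hd j i h0) ht
        have h2 : Real.exp (t * w j - t * w (e i)) ^ 2 ≤ 1 :=
          pow_le_one₀ (Real.exp_pos _).le h1
        nlinarith [sq_nonneg (d j i)]
    have hall := Finset.sum_le_sum fun j (_ : j ∈ Finset.univ) => hj j
    rw [← Finset.sum_mul] at hall
    have hexp : ∑ i, (√D * Real.exp (t * w (e i)) * ∑ m, Matrix.of (a ∘ e) i m * x m) ^ 2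
        = D * ∑ i, (Real.exp (t * w (e i)) * ∑ m, a (e i) m * x m) ^ 2 := by
      rw [Finset.mul_sum]
      refine Finset.sum_congr rfl fun i _ => ?_
      rw [mul_assoc, mul_pow, Real.sq_sqrt hD.le]
      rfl
    have hnn : 0 ≤ ∑ i, (Real.exp (t * w (e i)) * ∑ m, a (e i) m * x m) ^ 2 :=
      Finset.sum_nonneg fun i _ => sq_nonneg _
    rw [hexp]
    simp only [D, add_mul, one_mul]
    linarith
  refine le_trans (le_of_eq ?_) (mul_le_mul_left hint _)
  rw [← ENNReal.ofReal_mul (by positivity), mul_assoc _ (Real.exp _), ← Real.exp_add]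
  congr 3
  rw [mul_sub, Finset.mul_sum]
  simp_rw [mul_left_comm]
  ring

theorem gaussInt_ne_top {M N : ℕ} (a : Fin N → Fin M → ℝ)
    (hspan : Submodule.span ℝ (Set.range a) = ⊤) (w : Fin N → ℝ) :
    gaussInt a (fun j => Real.exp (w j)) ≠ ⊤ := by
  obtain ⟨e, he, -⟩ := exists_basis_of_weight a hspan w
  obtain ⟨C, -, hC⟩ := exists_gaussFun_le a
  have h := hC 0 w e he
  simp only [gaussFun, Pi.zero_apply, zero_mul, Finset.sum_const_zero, Real.exp_zero,
    ENNReal.ofReal_one, mul_one] at h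
  exact (h.trans_lt ENNReal.ofReal_lt_top).ne

theorem continuous_gaussFun {M N : ℕ} (a : Fin N → Fin M → ℝ)
    (hspan : Submodule.span ℝ (Set.range a) = ⊤) (z : Fin N → ℝ) :
    Continuous (gaussFun a z) := by
  rw [continuous_iff_continuousAt]
  intro w
  have hgt : ∀ᶠ v in nhds w, ∀ j, w j - 1 < v j :=
    Filter.eventually_all.2 fun j =>
      (continuous_apply j).continuousAt.eventually (lt_mem_nhds (sub_one_lt (w j)))
  have hint : Filter.Tendsto (fun v : Fin N → ℝ => gaussInt a (fun j => Real.exp (v j)))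
      (nhds w) (nhds (gaussInt a (fun j => Real.exp (w j)))) := by
    refine tendsto_lintegral_filter_of_dominated_convergence
      (fun x => ENNReal.ofReal (Real.exp
        (-(∑ j, (Real.exp (w j - 1) * ∑ m, a j m * x m) ^ 2) / 2)))
      (Filter.Eventually.of_forall fun v => by fun_prop) ?_
      (gaussInt_ne_top a hspan fun j => w j - 1)
      (Filter.Eventually.of_forall fun x => ?_)
    · filter_upwards [hgt] with v hv
      refine Filter.Eventually.of_forall fun x =>
        ENNReal.ofReal_le_ofReal (Real.exp_le_exp.2 ?_)
      have : ∑ j, (Real.exp (w j - 1) * ∑ m, a j m * x m) ^ 2 ≤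
          ∑ j, (Real.exp (v j) * ∑ m, a j m * x m) ^ 2 := by
        refine Finset.sum_le_sum fun j _ => ?_
        rw [mul_pow, mul_pow]
        gcongr
        exact (hv j).le
      linarith
    · exact Continuous.tendsto (f := fun v : Fin N → ℝ => ENNReal.ofReal (Real.exp
        (-(∑ j, (Real.exp (v j) * ∑ m, a j m * x m) ^ 2) / 2)))
        (ENNReal.continuous_ofReal.comp (by fun_prop)) w
  refine ENNReal.Tendsto.mul hint (Or.inr ENNReal.ofReal_ne_top)
    (Continuous.tendsto (f := fun v : Fin N → ℝ =>
      ENNReal.ofReal (Real.exp (∑ j, z j * v j))) (ENNReal.continuous_ofReal.comp (by fun_prop)) w)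
    (Or.inr (gaussInt_ne_top a hspan w))

theorem gaussFun_add_const {M N : ℕ} (a : Fin N → Fin M → ℝ) {z : Fin N → ℝ}
    (hz : ∑ j, z j = M) (w : Fin N → ℝ) (r : ℝ) :
    gaussFun a z (fun j => r + w j) = gaussFun a z w := by
  unfold gaussFun
  simp_rw [Real.exp_add, mul_add]
  rw [gaussInt_smul a _ (Real.exp_pos r), Finset.sum_add_distrib, ← Finset.sum_mul, hz,
    Real.exp_add, ENNReal.ofReal_mul (Real.exp_pos _).le, ← Real.exp_nat_mul,
    mul_mul_mul_comm, ← ENNReal.ofReal_mul (by positivity), inv_mul_cancel₀ (Real.exp_pos _).ne',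
    ENNReal.ofReal_one, one_mul]

theorem gaussFun_zero_pos {M N : ℕ} (a : Fin N → Fin M → ℝ)
    (hspan : Submodule.span ℝ (Set.range a) = ⊤) (z : Fin N → ℝ) :
    0 < gaussFun a z 0 := by
  obtain ⟨e, he, hmem⟩ := exists_basis_of_weight a hspan 0
  obtain ⟨c, hc, h⟩ := exists_le_gaussFun a 0 e he hmem
  have h0 := h z 0 le_rfl
  simp only [Pi.zero_apply, mul_zero, zero_mul, Real.exp_zero, mul_one] at h0
  exact (ENNReal.ofReal_pos.2 hc).trans_le h0

theorem nonpos_of_mul_exp_le {c r B : ℝ} (hc : 0 < c)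
    (h : ∀ t : ℝ, 0 ≤ t → c * Real.exp (t * r) ≤ B) : r ≤ 0 := by
  by_contra! hr
  have hB : c ≤ B := by simpa using h 0 le_rfl
  have ht := h (B / (c * r)) (by have := hc.le.trans hB; positivity)
  have hexp := mul_le_mul_of_nonneg_left (Real.add_one_le_exp (B / (c * r) * r)) hc.le
  have : c * (B / (c * r) * r + 1) = B + c := by field_simp
  linarith

theorem sum_mul_le_of_iSup_gaussFun_lt_top {M N : ℕ} {a : Fin N → Fin M → ℝ} {z : Fin N → ℝ}
    (hfin : ⨆ w, gaussFun a z w < ⊤) {w : Fin N → ℝ} {e : Fin M → Fin N}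
    (he : LinearIndependent ℝ (a ∘ e))
    (hmem : ∀ j, a j ∈ Submodule.span ℝ ((a ∘ e) '' {i | w j ≤ w (e i)})) :
    ∑ j, z j * w j ≤ ∑ i, w (e i) := by
  obtain ⟨c, hc, h⟩ := exists_le_gaussFun a w e he hmem
  refine sub_nonpos.1 (nonpos_of_mul_exp_le (B := (⨆ w, gaussFun a z w).toReal) hc
    fun t ht => ?_)
  exact (ENNReal.ofReal_le_iff_le_toReal hfin.ne).1
    ((h z t ht).trans (le_iSup (gaussFun a z) _))

theorem sum_le_finrank_of_iSup_gaussFun_lt_top {M N : ℕ} {a : Fin N → Fin M → ℝ}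
    {z : Fin N → ℝ} (hspan : Submodule.span ℝ (Set.range a) = ⊤)
    (hfin : ⨆ w, gaussFun a z w < ⊤) (S : Finset (Fin N)) :
    ∑ j ∈ S, z j ≤ Module.finrank ℝ (Submodule.span ℝ (a '' ↑S)) := by
  classical
  obtain ⟨e, he, hmem⟩ := exists_basis_of_weight a hspan fun j => if j ∈ S then 1 else 0
  have h := sum_mul_le_of_iSup_gaussFun_lt_top hfin he hmem
  rw [Finset.sum_boole] at h
  have hS : ∑ j, z j * (if j ∈ S then 1 else 0) = ∑ j ∈ S, z j := by simp
  rw [hS] at h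
  refine h.trans (Nat.cast_le.2 ?_)
  have hli : LinearIndependent ℝ
      (fun i : {i // e i ∈ S} => (⟨a (e i), Submodule.subset_span ⟨e i, i.2, rfl⟩⟩ :
        Submodule.span ℝ (a '' ↑S))) :=
    LinearIndependent.of_comp (Submodule.span ℝ (a '' ↑S)).subtype
      (he.comp (fun i : {i // e i ∈ S} => (i : Fin M)) Subtype.val_injective)
  rw [← Fintype.card_subtype]
  exact hli.fintype_card_le_finrank

theorem sum_eq_of_iSup_gaussFun_lt_top {M N : ℕ} {a : Fin N → Fin M → ℝ}
    {z : Fin N → ℝ} (hspan : Submodule.span ℝ (Set.range a) = ⊤)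
    (hfin : ⨆ w, gaussFun a z w < ⊤) : ∑ j, z j = M := by
  refine le_antisymm ?_ ?_
  · have h := sum_le_finrank_of_iSup_gaussFun_lt_top hspan hfin Finset.univ
    rw [Finset.coe_univ, Set.image_univ, hspan, finrank_top, Module.finrank_fin_fun] at h
    exact h
  · obtain ⟨e, he, hmem⟩ := exists_basis_of_weight a hspan fun _ => -1
    have h := sum_mul_le_of_iSup_gaussFun_lt_top hfin he hmem
    simp at h
    linarith

theorem iSup_gaussFun_lt_top {M N : ℕ} {a : Fin N → Fin M → ℝ} {z : Fin N → ℝ}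
    (hspan : Submodule.span ℝ (Set.range a) = ⊤) (hsum : ∑ j, z j = M)
    (hz : ∀ S : Finset (Fin N),
      ∑ j ∈ S, z j ≤ Module.finrank ℝ (Submodule.span ℝ (a '' ↑S))) :
    ⨆ w, gaussFun a z w < ⊤ := by
  obtain ⟨C, hC, h⟩ := exists_gaussFun_le a
  refine lt_of_le_of_lt (iSup_le fun w => ?_) (ENNReal.ofReal_lt_top (r := C))
  obtain ⟨e, he, hle, -⟩ := exists_basis_sum_le a hspan z w le_rfl hsum
    fun S _ _ => by simpa using hz S
  refine (h z w e he).trans (ENNReal.ofReal_le_ofReal (mul_le_of_le_one_right hC ?_))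
  exact Real.exp_le_one_iff.2 (sub_nonpos.2 hle)

theorem exists_gaussFun_eq_iSup {M N : ℕ} {a : Fin N → Fin M → ℝ} {z : Fin N → ℝ}
    (hspan : Submodule.span ℝ (Set.range a) = ⊤) (hsum : ∑ j, z j = M)
    (hz : ∀ S : Finset (Fin N), S.Nonempty → S ≠ Finset.univ →
      ∑ j ∈ S, z j < Module.finrank ℝ (Submodule.span ℝ (a '' ↑S))) :
    ∃ w, gaussFun a z w = ⨆ w, gaussFun a z w := by
  classical
  obtain ⟨δ, hδ, hδz⟩ : ∃ δ : ℝ, 0 < δ ∧ ∀ S : Finset (Fin N), S.Nonempty → S ≠ Finset.univ →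
      ∑ j ∈ S, z j + δ ≤ Module.finrank ℝ (Submodule.span ℝ (a '' ↑S)) := by
    let gap : Finset (Fin N) → ℝ := fun S =>
      if S.Nonempty ∧ S ≠ Finset.univ then
        Module.finrank ℝ (Submodule.span ℝ (a '' ↑S)) - ∑ j ∈ S, z j else 1
    have hpos : ∀ S, 0 < gap S := by
      intro S
      by_cases hS : S.Nonempty ∧ S ≠ Finset.univ
      · simpa [gap, hS] using hz S hS.1 hS.2
      · simp only [gap, if_neg hS, one_pos]
    obtain ⟨S₀, hS₀⟩ := Finite.exists_min gap
    refine ⟨gap S₀, hpos S₀, fun S h1 h2 => ?_⟩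
    have := hS₀ S
    rw [show gap S = _ from if_pos ⟨h1, h2⟩] at this
    linarith
  obtain ⟨C, hC, h⟩ := exists_gaussFun_le a
  have hdecay : ∀ w j k, gaussFun a z w ≤
      ENNReal.ofReal (C * Real.exp (-(δ * (w j - w k)))) := by
    intro w j k
    obtain ⟨e, he, -, hosc⟩ := exists_basis_sum_le a hspan z w hδ.le hsum hδz
    refine (h z w e he).trans (ENNReal.ofReal_le_ofReal
      (mul_le_mul_of_nonneg_left (Real.exp_le_exp.2 ?_) hC))
    linarith [hosc j k]
  obtain ⟨R, hR0, hR⟩ : ∃ R : ℝ, 0 ≤ R ∧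
      ENNReal.ofReal (C * Real.exp (-(δ * R))) ≤ gaussFun a z 0 := by
    have hlim : Filter.Tendsto (fun R : ℝ => ENNReal.ofReal (C * Real.exp (-(δ * R))))
        Filter.atTop (nhds 0) := by
      rw [← ENNReal.ofReal_zero, ← mul_zero C]
      exact ENNReal.tendsto_ofReal ((Real.tendsto_exp_neg_atTop_nhds_zero.comp
        (Filter.tendsto_id.const_mul_atTop hδ)).const_mul C)
    obtain ⟨R, h0, h1⟩ := ((Filter.eventually_ge_atTop (0 : ℝ)).and
      (hlim.eventually (gt_mem_nhds (gaussFun_zero_pos a hspan z)))).exists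
    exact ⟨R, h0, h1.le⟩
  have hK : IsCompact (Set.univ.pi fun _ : Fin N => Set.Icc (-R) R) :=
    isCompact_univ_pi fun _ => isCompact_Icc
  have h0K : (0 : Fin N → ℝ) ∈ Set.univ.pi fun _ : Fin N => Set.Icc (-R) R :=
    fun j _ => ⟨neg_nonpos.2 hR0, hR0⟩
  obtain ⟨v, -, hv⟩ := hK.exists_isMaxOn ⟨0, h0K⟩ (continuous_gaussFun a hspan z).continuousOn
  refine ⟨v, le_antisymm (le_iSup (gaussFun a z) v) (iSup_le fun w => ?_)⟩
  by_cases hw : ∃ j k, R < w j - w k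
  · obtain ⟨j, k, hjk⟩ := hw
    refine (hdecay w j k).trans (le_trans (ENNReal.ofReal_le_ofReal
      (mul_le_mul_of_nonneg_left (Real.exp_le_exp.2 ?_) hC)) (hR.trans (hv h0K)))
    exact neg_le_neg (mul_le_mul_of_nonneg_left hjk.le hδ.le)
  · push Not at hw
    obtain ⟨r, hr⟩ : ∃ r : ℝ, ∀ j, |r + w j| ≤ R := by
      rcases isEmpty_or_nonempty (Fin N) with hN | ⟨⟨k⟩⟩
      · exact ⟨0, fun j => hN.elim j⟩
      · exact ⟨-w k, fun j => abs_le.2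
          ⟨by linarith [hw k j], by linarith [hw j k]⟩⟩
    rw [← gaussFun_add_const a hsum w r]
    exact hv fun j _ => ⟨(abs_le.1 (hr j)).1, (abs_le.1 (hr j)).2⟩

/-- Barthe: `D_G(p) < ∞` iff `z = (1/p_j)_j ∈ K_A`, i.e. iff
`∑_j 1/p_j = M` and `∑_{j∈S} 1/p_j ≤ dim span{a_j : j∈S}` for every `S`; and if
`z` lies in the relative interior `K_A°` the Gaussian supremum is attained. -/
theorem BLGaussConst_finite_iff_and_attained (M N : ℕ)
    (a : Fin N → Fin M → ℝ) (ha : ∀ j, a j ≠ 0)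
    (hspan : Submodule.span ℝ (Set.range a) = ⊤)
    (p : Fin N → ℝ≥0∞) (hp : ∀ j, 1 ≤ p j) :
    (BLGaussConst M N a p < ⊤ ↔
      ((∑ j, (p j)⁻¹) = (M : ℝ≥0∞) ∧
        ∀ S : Finset (Fin N), (∑ j ∈ S, (p j)⁻¹) ≤
          (Module.finrank ℝ (Submodule.span ℝ (a '' ↑S)) : ℝ≥0∞))) ∧
    (((∑ j, (p j)⁻¹) = (M : ℝ≥0∞) ∧
        ∀ S : Finset (Fin N), S.Nonempty → S ≠ Finset.univ →
          (∑ j ∈ S, (p j)⁻¹) <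
            (Module.finrank ℝ (Submodule.span ℝ (a '' ↑S)) : ℝ≥0∞)) →
      ∃ c s : Fin N → ℝ, (∀ j, 0 < c j ∧ 0 < s j) ∧
        BLratio M N a p (fun j y => c j * Real.exp (-(s j * y) ^ 2 / 2)) =
          BLGaussConst M N a p) := by
  have hne : ∀ j, (p j)⁻¹ ≠ ⊤ := fun j => ENNReal.inv_ne_top.2 (one_pos.trans_le (hp j)).ne'
  have hsumS : ∀ S : Finset (Fin N),
      ∑ j ∈ S, (p j)⁻¹ = ENNReal.ofReal (∑ j ∈ S, ((p j)⁻¹).toReal) := by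
    intro S
    rw [ENNReal.ofReal_sum_of_nonneg fun j _ => ENNReal.toReal_nonneg]
    exact Finset.sum_congr rfl fun j _ => (ENNReal.ofReal_toReal (hne j)).symm
  have hnn : ∀ S : Finset (Fin N), 0 ≤ ∑ j ∈ S, ((p j)⁻¹).toReal :=
    fun S => Finset.sum_nonneg fun j _ => ENNReal.toReal_nonneg
  have hle : ∀ (S : Finset (Fin N)) (d : ℕ),
      ∑ j ∈ S, (p j)⁻¹ ≤ (d : ℝ≥0∞) ↔ ∑ j ∈ S, ((p j)⁻¹).toReal ≤ d := by
    intro S d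
    rw [hsumS, ← ENNReal.ofReal_natCast, ENNReal.ofReal_le_ofReal_iff (Nat.cast_nonneg d)]
  have hlt : ∀ (S : Finset (Fin N)) (d : ℕ),
      ∑ j ∈ S, (p j)⁻¹ < (d : ℝ≥0∞) ↔ ∑ j ∈ S, ((p j)⁻¹).toReal < d := by
    intro S d
    rw [hsumS, ← ENNReal.ofReal_natCast, ENNReal.ofReal_lt_ofReal_iff_of_nonneg (hnn S)]
  have heq : ∑ j, (p j)⁻¹ = (M : ℝ≥0∞) ↔ ∑ j, ((p j)⁻¹).toReal = M := by
    rw [hsumS, ← ENNReal.ofReal_natCast,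
      ENNReal.ofReal_eq_ofReal_iff (hnn _) (Nat.cast_nonneg M)]
  obtain ⟨K, hK, hratio, hconst⟩ := exists_BLGaussConst_eq a p hp
  have hfin : BLGaussConst M N a p < ⊤ ↔
      ⨆ w, gaussFun a (fun j => ((p j)⁻¹).toReal) w < ⊤ := by
    rw [hconst]
    refine ⟨fun h => ?_, fun h => ENNReal.mul_lt_top ENNReal.ofReal_lt_top h⟩
    exact ENNReal.lt_top_of_mul_ne_top_right h.ne (ENNReal.ofReal_pos.2 hK).ne'
  simp only [hfin, hle, hlt, heq]
  refine ⟨⟨fun h => ⟨sum_eq_of_iSup_gaussFun_lt_top hspan h,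
    sum_le_finrank_of_iSup_gaussFun_lt_top hspan h⟩,
    fun h => iSup_gaussFun_lt_top hspan h.1 h.2⟩, fun h => ?_⟩
  obtain ⟨w, hw⟩ := exists_gaussFun_eq_iSup hspan h.1 h.2
  exact ⟨fun _ => 1, fun j => Real.exp (w j), fun j => ⟨one_pos, Real.exp_pos _⟩, by
    rw [hratio w, hconst, hw]⟩
end
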